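/- arXiv:1505.06708 — 11 statements merged into one kernel-verified Lean document; each statement's English description precedes it below -/
import Mathlib

section
/- There exists an absolute constant C > 0 with the following property: for all integers n, a, m, x, y with n ≥ 0, a ≥ 1, m ≥ 1, x·y ≠ 0 and 0 < |F_{n,a}(x, y)| ≤ m, one has a ≤ C·max{ 1, (1 + log|x|)·log log(n+3), log|y|, (log m)/log(n+2) }. -/
noncomputable section

/-- The polynomial `f_n(X) = X³ − (n−1)X² − (n+2)X − 1`. -/
def fn (n : ℤ) (X : ℝ) : ℝ := X ^ 3 - ((n : ℝ) - 1) * X ^ 2 - ((n : ℝ) + 2) * X - 1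

/-- `l0, l1, l2` are the three distinct real roots of `f_n`. -/
def IsRoots (n : ℤ) (l0 l1 l2 : ℝ) : Prop :=
  fn n l0 = 0 ∧ fn n l1 = 0 ∧ fn n l2 = 0 ∧ l0 ≠ l1 ∧ l0 ≠ l2 ∧ l1 ≠ l2

/-- The form `F_{n,a}(x,y) = ∏ (x − λᵃ y)` over the three roots `λ` of `f_n`. -/
def Fna (a : ℤ) (l0 l1 l2 x y : ℝ) : ℝ :=
  (x - l0 ^ a * y) * (x - l1 ^ a * y) * (x - l2 ^ a * y)

open Polynomial in
theorem alternating_sum_choose_mul_eval_eq_zero (p : ℤ[X]) (i : ℕ) (hp : p.natDegree < i) :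
    ∑ j ∈ Finset.range (i + 1), (-1 : ℤ) ^ j * (i.choose j : ℤ) * p.eval (j : ℤ) = 0 := by
  have h := congrFun (Polynomial.fwdDiff_iter_eq_zero_of_degree_lt hp) 0
  rw [fwdDiff_iter_eq_sum_shift] at h
  have h2 : ∑ j ∈ Finset.range (i + 1), (-1 : ℤ) ^ j * (i.choose j : ℤ) * p.eval (j : ℤ)
      = (-1) ^ i * ∑ j ∈ Finset.range (i + 1),
        ((-1 : ℤ) ^ (i - j) * (i.choose j : ℤ)) • p.eval (0 + j • (1 : ℤ)) := by
    rw [Finset.mul_sum]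
    refine Finset.sum_congr rfl fun j hj => ?_
    have hj' : j ≤ i := by simpa [Nat.lt_succ_iff] using hj
    obtain ⟨d, rfl⟩ := Nat.exists_eq_add_of_le hj'
    have : ((-1 : ℤ) ^ d) * (-1) ^ d = 1 := by rw [← mul_pow]; simp
    simp only [Nat.add_sub_cancel_left, smul_eq_mul, nsmul_eq_mul, mul_one, zero_add, pow_add]
    linear_combination (-(-1 : ℤ) ^ j * ((j + d).choose j : ℤ) * p.eval (j : ℤ)) * this
  rw [h2, h]
  simp

/-- Coefficients of the denominator of the `(k, k)` Padé approximant to `(1 + X) ^ a`. -/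
def padeCoeff (a k j : ℕ) : ℤ :=
  (-1) ^ j * ((2 * k - j).choose k : ℤ) * ((a - k - 1 + j).choose j : ℤ)

open Polynomial in
/-- The denominator of the `(k, k)` Padé approximant to `(1 + X) ^ a`. -/
def padeDenom (a k : ℕ) : ℤ[X] :=
  ∑ j ∈ Finset.range (k + 1), C (padeCoeff a k j) * X ^ j

open Polynomial in
/-- Polynomial interpolating, up to a constant, the terms of the coefficient of `X ^ i` in
`padeDenom a k * (1 + X) ^ a`. -/
def padeWeight (a k i : ℕ) : ℤ[X] :=
  (descPochhammer ℤ k).comp (C (2 * k : ℤ) - X) *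
    (descPochhammer ℤ (i - k - 1)).comp (X + C ((a - k - 1 : ℕ) : ℤ))

theorem natDegree_padeWeight_lt {a k i : ℕ} (hk : k < i) : (padeWeight a k i).natDegree < i := by
  refine lt_of_le_of_lt Polynomial.natDegree_mul_le ?_
  rw [Polynomial.natDegree_comp, Polynomial.natDegree_comp, descPochhammer_natDegree,
    descPochhammer_natDegree, Polynomial.natDegree_X_add_C]
  have : (Polynomial.C (2 * k : ℤ) - Polynomial.X).natDegree ≤ 1 := by
    refine (Polynomial.natDegree_sub_le _ _).trans ?_
    rw [Polynomial.natDegree_C, Polynomial.natDegree_X, max_eq_right zero_le_one]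
  have := Nat.mul_le_mul_left k this
  omega

theorem eval_padeWeight {a k i j : ℕ} (hj : j ≤ 2 * k) :
    (padeWeight a k i).eval (j : ℤ) =
      ((2 * k - j).descFactorial k : ℤ) * ((a - k - 1 + j).descFactorial (i - k - 1) : ℤ) := by
  rw [padeWeight, Polynomial.eval_mul, Polynomial.eval_comp, Polynomial.eval_comp,
    ← descPochhammer_eval_eq_descFactorial, ← descPochhammer_eval_eq_descFactorial]
  congr 2
  · simp [Nat.cast_sub hj]
  · simp [add_comm]

theorem factorial_mul_choose_mul_choose {a k i j : ℕ} (hjk : j ≤ k) (hk : k < i) (hi : i ≤ a) :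
    i.factorial * (a - k - 1).factorial * ((a - k - 1 + j).choose j * a.choose (i - j)) =
      a.factorial * (i.choose j * (a - k - 1 + j).descFactorial (i - k - 1)) := by
  have hA : (a - k - 1 + j).choose j * j.factorial * (a - k - 1).factorial
      = (a - k - 1 + j).factorial := by
    have := Nat.choose_mul_factorial_mul_factorial (n := a - k - 1 + j) (k := j) (by omega)
    rwa [Nat.add_sub_cancel] at this
  have hB := Nat.choose_mul_factorial_mul_factorial (n := a) (k := i - j) (by omega)
  have hC := Nat.choose_mul_factorial_mul_factorial (n := i) (k := j) (by omega)
  have hD := Nat.factorial_mul_descFactorial (n := a - k - 1 + j) (k := i - k - 1) (by omega)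
  rw [show a - k - 1 + j - (i - k - 1) = a - (i - j) by omega] at hD
  have hpos : 0 < j.factorial * (i - j).factorial * (a - (i - j)).factorial := by positivity
  refine Nat.eq_of_mul_eq_mul_right hpos ?_
  calc _ = i.factorial * ((a - k - 1 + j).choose j * j.factorial * (a - k - 1).factorial) *
        (a.choose (i - j) * (i - j).factorial * (a - (i - j)).factorial) := by ring
    _ = i.factorial * (a - k - 1 + j).factorial * a.factorial := by rw [hA, hB]
    _ = (i.choose j * j.factorial * (i - j).factorial) *
        ((a - (i - j)).factorial * (a - k - 1 + j).descFactorial (i - k - 1)) * a.factorial := by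
      rw [hC, hD]
    _ = _ := by ring

open Polynomial in
theorem coeff_padeDenom_mul {a k i : ℕ} (hk : k ≤ i) :
    (padeDenom a k * (1 + X) ^ a).coeff i =
      ∑ j ∈ Finset.range (k + 1), padeCoeff a k j * (a.choose (i - j) : ℤ) := by
  rw [padeDenom, Finset.sum_mul, finsetSum_coeff]
  refine Finset.sum_congr rfl fun j hj => ?_
  have hj' : j ≤ i := by simp at hj; omega
  rw [mul_assoc, coeff_C_mul, coeff_X_pow_mul', if_pos hj', coeff_one_add_X_pow]

open Polynomial in
theorem factorial_mul_coeff_padeDenom_mul {a k i : ℕ} (hk : k < i) (hi : i ≤ a) :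
    ((i.factorial * (a - k - 1).factorial * k.factorial : ℕ) : ℤ) *
      (padeDenom a k * (1 + X) ^ a).coeff i =
    a.factorial * ∑ j ∈ Finset.range (k + 1),
      (-1 : ℤ) ^ j * (i.choose j : ℤ) * (padeWeight a k i).eval (j : ℤ) := by
  rw [coeff_padeDenom_mul hk.le, Finset.mul_sum, Finset.mul_sum]
  refine Finset.sum_congr rfl fun j hj => ?_
  have hjk : j ≤ k := by simpa [Nat.lt_succ_iff] using hj
  rw [eval_padeWeight (by omega), padeCoeff, Nat.descFactorial_eq_factorial_mul_choose (2 * k - j)]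
  have := congrArg (Nat.cast : ℕ → ℤ) (factorial_mul_choose_mul_choose hjk hk hi)
  push_cast at this ⊢
  linear_combination ((-1 : ℤ) ^ j * (k.factorial : ℤ) * ((2 * k - j).choose k : ℤ)) * this

open Polynomial in
theorem coeff_padeDenom_mul_eq_zero {a k i : ℕ} (hk : k < i) (hi : i ≤ a) (hi2 : i ≤ 2 * k) :
    (padeDenom a k * (1 + X) ^ a).coeff i = 0 := by
  have h := factorial_mul_coeff_padeDenom_mul hk hi
  have h0 := alternating_sum_choose_mul_eval_eq_zero _ i (natDegree_padeWeight_lt (a := a) hk)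
  rw [← Finset.sum_subset (s₁ := Finset.range (k + 1))] at h0
  · rw [h0, mul_zero] at h
    exact (mul_eq_zero.mp h).resolve_left (by positivity)
  · exact Finset.range_subset_range.mpr (by omega)
  · intro j hj hj'
    simp only [Finset.mem_range] at hj hj'
    rw [eval_padeWeight (by omega), Nat.descFactorial_of_lt (by omega)]
    simp

open Polynomial in
theorem coeff_padeDenom_mul_ne_zero {a k : ℕ} (ha : 2 * k + 1 ≤ a) :
    (padeDenom a k * (1 + X) ^ a).coeff (2 * k + 1) ≠ 0 := by
  intro hc
  have h := factorial_mul_coeff_padeDenom_mul (k := k) (by omega) ha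
  have h0 := alternating_sum_choose_mul_eval_eq_zero _ (2 * k + 1)
    (natDegree_padeWeight_lt (a := a) (k := k) (by omega))
  rw [Finset.sum_range_succ, ← Finset.sum_subset (s₁ := Finset.range (k + 1))] at h0
  · rw [hc, mul_zero, eq_comm, mul_eq_zero] at h
    rw [h.resolve_left (by positivity), zero_add, Nat.choose_self, padeWeight, eval_mul, eval_comp,
      eval_comp] at h0
    have e1 : eval ((2 * k + 1 : ℕ) : ℤ) (C (2 * k : ℤ) - X) = -1 := by simp
    have e2 : eval ((2 * k + 1 : ℕ) : ℤ) (X + C ((a - k - 1 : ℕ) : ℤ)) = ((a + k : ℕ) : ℤ) := by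
      simp only [eval_add, eval_X, eval_C]
      omega
    rw [e1, e2, descPochhammer_eval_eq_descFactorial, descPochhammer_eval_eq_prod_range] at h0
    refine absurd h0 (mul_ne_zero (by simp) (mul_ne_zero ?_ ?_))
    · refine Finset.prod_ne_zero_iff.mpr fun j _ => by omega
    · have := Nat.descFactorial_eq_zero_iff_lt (n := a + k) (k := 2 * k + 1 - k - 1)
      exact_mod_cast fun h => absurd (this.mp h) (by omega)
  · exact Finset.range_subset_range.mpr (by omega)
  · intro j hj hj'
    simp only [Finset.mem_range] at hj hj'
    rw [eval_padeWeight (by omega), Nat.descFactorial_of_lt (by omega)]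
    simp

theorem abs_padeCoeff_le {a k j : ℕ} (ha : 4 * k ≤ a) (hj : j ≤ k) :
    |padeCoeff a k j| ≤ 2 ^ (2 * a) := by
  rw [padeCoeff, abs_mul, abs_mul, abs_pow, abs_neg, abs_one, one_pow, one_mul, Nat.abs_cast,
    Nat.abs_cast]
  have h1 : (2 * k - j).choose k ≤ 2 ^ a :=
    (Nat.choose_le_two_pow _ _).trans (Nat.pow_le_pow_right two_pos (by omega))
  have h2 : (a - k - 1 + j).choose j ≤ 2 ^ a :=
    (Nat.choose_le_two_pow _ _).trans (Nat.pow_le_pow_right two_pos (by omega))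
  have := Nat.mul_le_mul h1 h2
  rw [two_mul a, pow_add]
  exact_mod_cast this

theorem coeff_padeDenom (a k j : ℕ) :
    (padeDenom a k).coeff j = if j ≤ k then padeCoeff a k j else 0 := by
  simp [padeDenom, Polynomial.coeff_X_pow]

theorem abs_coeff_padeDenom_le {a k : ℕ} (ha : 4 * k ≤ a) (j : ℕ) :
    |(padeDenom a k).coeff j| ≤ 2 ^ (2 * a) := by
  rw [coeff_padeDenom]
  split_ifs with h
  · exact abs_padeCoeff_le ha h
  · simp

theorem natDegree_padeDenom_le (a k : ℕ) : (padeDenom a k).natDegree ≤ k := by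
  refine Polynomial.natDegree_le_iff_coeff_eq_zero.mpr fun j hj => ?_
  rw [coeff_padeDenom, if_neg (by omega)]

open Polynomial in
theorem natDegree_padeDenom_mul_le {a k : ℕ} (ha : 4 * k ≤ a) :
    (padeDenom a k * (1 + X) ^ a).natDegree ≤ 2 * a := by
  refine natDegree_mul_le.trans ?_
  have h1 := natDegree_padeDenom_le a k
  have h2 : ((1 + X : ℤ[X]) ^ a).natDegree ≤ a := by
    refine natDegree_pow_le.trans ?_
    have : (1 + X : ℤ[X]).natDegree ≤ 1 := by
      rw [add_comm, ← C_1, natDegree_X_add_C]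
    nlinarith
  omega

open Polynomial in
theorem abs_coeff_padeDenom_mul_le {a k : ℕ} (ha : 4 * k ≤ a) (i : ℕ) :
    |(padeDenom a k * (1 + X) ^ a).coeff i| ≤ 2 ^ (5 * a) := by
  by_cases hi : i ≤ 2 * a
  · rw [coeff_mul]
    have hterm : ∀ x ∈ Finset.HasAntidiagonal.antidiagonal i,
        |(padeDenom a k).coeff x.1 * ((1 + X : ℤ[X]) ^ a).coeff x.2| ≤ 2 ^ (3 * a) := by
      intro x _
      rw [abs_mul, coeff_one_add_X_pow, Nat.abs_cast, show 3 * a = 2 * a + a by ring, pow_add]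
      exact mul_le_mul (abs_coeff_padeDenom_le ha _) (by exact_mod_cast Nat.choose_le_two_pow _ _)
        (by positivity) (by positivity)
    refine (Finset.abs_sum_le_sum_abs _ _).trans ((Finset.sum_le_card_nsmul _ _ _ hterm).trans ?_)
    have : i + 1 ≤ 2 ^ (2 * a) := by
      have := Nat.lt_two_pow_self (n := 2 * a)
      omega
    rw [Finset.Nat.card_antidiagonal, nsmul_eq_mul, show 5 * a = 2 * a + 3 * a by ring, pow_add]
    exact mul_le_mul_of_nonneg_right (by exact_mod_cast this) (by positivity)
  · rw [coeff_eq_zero_of_natDegree_lt ((natDegree_padeDenom_mul_le ha).trans_lt (by omega))]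
    simp

open Polynomial in
/-- Padé approximants to `(1 + X) ^ a`, with integral coefficients of exponential size. -/
theorem exists_pade {a k : ℕ} (hk : 1 ≤ k) (ha : 4 * k ≤ a) :
    ∃ P Q R : ℤ[X], Q * (1 + X) ^ a = P + X ^ (2 * k + 1) * R ∧
      P.natDegree ≤ k ∧ Q.natDegree ≤ k ∧ R.natDegree ≤ 2 * a ∧
      (∀ i, |P.coeff i| ≤ 2 ^ (5 * a)) ∧ (∀ i, |Q.coeff i| ≤ 2 ^ (5 * a)) ∧
      (∀ i, |R.coeff i| ≤ 2 ^ (5 * a)) ∧ Q.coeff 0 ≠ 0 ∧ R.coeff 0 ≠ 0 := by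
  set S := padeDenom a k * (1 + X) ^ a with hS
  set P : ℤ[X] := ∑ i ∈ Finset.range (k + 1), C (S.coeff i) * X ^ i with hP
  have hPc : ∀ i, P.coeff i = if i ≤ k then S.coeff i else 0 := fun i => by
    simp [hP, coeff_X_pow]
  have hdvd : X ^ (2 * k + 1) ∣ S - P := by
    refine X_pow_dvd_iff.mpr fun d hd => ?_
    rw [coeff_sub, hPc]
    split_ifs with h
    · simp
    · rw [coeff_padeDenom_mul_eq_zero (by omega) (by omega) (by omega), sub_zero]
  obtain ⟨R, hR⟩ := hdvd
  have hRc : ∀ i, R.coeff i = S.coeff (i + (2 * k + 1)) := fun i => by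
    rw [← coeff_X_pow_mul R (2 * k + 1) i, ← hR, coeff_sub, hPc, if_neg (by omega), sub_zero]
  refine ⟨P, padeDenom a k, R, ?_, ?_, natDegree_padeDenom_le a k, ?_, ?_, ?_, ?_, ?_, ?_⟩
  · rw [← hR]; ring
  · refine natDegree_le_iff_coeff_eq_zero.mpr fun j hj => ?_
    rw [hPc, if_neg (by omega)]
  · refine natDegree_le_iff_coeff_eq_zero.mpr fun j hj => ?_
    rw [hRc]
    exact coeff_eq_zero_of_natDegree_lt ((natDegree_padeDenom_mul_le ha).trans_lt (by omega))
  · intro i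
    rw [hPc]
    split_ifs
    · exact abs_coeff_padeDenom_mul_le ha i
    · simp
  · exact fun i => (abs_coeff_padeDenom_le ha i).trans (pow_le_pow_right₀ (by norm_num) (by omega))
  · exact fun i => by rw [hRc]; exact abs_coeff_padeDenom_mul_le ha _
  · rw [coeff_padeDenom, if_pos (by omega), padeCoeff]
    simpa using (Nat.choose_pos (by omega)).ne'
  · rw [hRc, zero_add]
    exact coeff_padeDenom_mul_ne_zero (by omega)

open Polynomial in
theorem pade_det_ne_zero {k : ℕ} {W P Q R P' Q' R' : ℤ[X]}
    (h : Q * W = P + X ^ (2 * k + 1) * R) (h' : Q' * W = P' + X ^ (2 * (k + 1) + 1) * R')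
    (hP : P.natDegree ≤ k) (hQ : Q.natDegree ≤ k)
    (hP' : P'.natDegree ≤ k + 1) (hQ' : Q'.natDegree ≤ k + 1)
    (hQ0 : Q'.coeff 0 ≠ 0) (hR0 : R.coeff 0 ≠ 0) {z : ℝ} (hz : z ≠ 0) :
    aeval z P * aeval z Q' ≠ aeval z P' * aeval z Q := by
  set G : ℤ[X] := X ^ 2 * R' * Q - R * Q' with hG
  have hD : P * Q' - P' * Q = G * X ^ (2 * k + 1) := by
    rw [hG]
    linear_combination (-Q') * h + Q * h'
  have hG0 : G.coeff 0 ≠ 0 := by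
    rw [hG, coeff_zero_eq_eval_zero]
    simp only [eval_sub, eval_mul, eval_pow, eval_X, ← coeff_zero_eq_eval_zero]
    simp [hQ0, hR0]
  have hGne : G ≠ 0 := fun h => hG0 (by simp [h])
  have hdeg : (P * Q' - P' * Q).natDegree ≤ 2 * k + 1 := by
    refine (natDegree_sub_le _ _).trans (max_le ?_ ?_) <;>
    · refine natDegree_mul_le.trans ?_
      omega
  rw [hD, natDegree_mul_X_pow _ hGne] at hdeg
  have hGC := eq_C_of_natDegree_eq_zero (p := G) (by omega)
  intro heq
  have := congrArg (aeval z) hD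
  rw [hGC] at this
  simp only [map_sub, map_mul, map_pow, aeval_X, heq, sub_self, aeval_C] at this
  have h2 := mul_ne_zero (Int.cast_ne_zero (α := ℝ).mpr hG0) (pow_ne_zero (2 * k + 1) hz)
  exact h2 (by simpa using this.symm)

open Polynomial in
theorem abs_aeval_le {p : ℤ[X]} {N : ℕ} {B r t : ℝ} (hp : p.natDegree ≤ N)
    (hB : ∀ i, |(p.coeff i : ℝ)| ≤ B) (hr : 1 ≤ r) (ht : |t| ≤ r) :
    |aeval t p| ≤ (N + 1) * (B * r ^ N) := by
  have hB0 : 0 ≤ B := (abs_nonneg _).trans (hB 0)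
  rw [aeval_eq_sum_range' (Nat.lt_succ_of_le hp)]
  have hterm : ∀ i ∈ Finset.range (N + 1), |p.coeff i • t ^ i| ≤ B * r ^ N := by
    intro i hi
    rw [zsmul_eq_mul, abs_mul, abs_pow]
    refine mul_le_mul (hB i) ?_ (by positivity) hB0
    exact (pow_le_pow_left₀ (abs_nonneg t) ht i).trans
      (pow_le_pow_right₀ hr (by simp at hi; omega))
  refine (Finset.abs_sum_le_sum_abs _ _).trans ((Finset.sum_le_card_nsmul _ _ _ hterm).trans ?_)
  simp

/-- A root `L` of `f_n` determines its conjugates `-1 / (1 + L)` and `-(1 + 1 / L)`. -/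
theorem fn_eq_mul {n : ℤ} {L : ℝ} (hL : 0 < L) (h : fn n L = 0) (X : ℝ) :
    fn n X = (X - L) * (X - -1 / (1 + L)) * (X - -(1 + 1 / L)) := by
  have h1 : (1 + L) ≠ 0 := by positivity
  have hn : (n : ℝ) = (L ^ 3 + L ^ 2 - 2 * L - 1) / (L * (1 + L)) := by
    rw [eq_div_iff (by positivity)]
    rw [fn] at h
    linear_combination -h
  rw [fn, hn]
  field_simp
  ring

theorem IsRoots.fn_eq {n : ℤ} {l0 l1 l2 : ℝ} (h : IsRoots n l0 l1 l2) (X : ℝ) :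
    fn n X = (X - l0) * (X - l1) * (X - l2) := by
  obtain ⟨h0, h1, h2, h01, h02, h12⟩ := h
  have d01 : l0 ^ 2 + l0 * l1 + l1 ^ 2 - ((n : ℝ) - 1) * (l0 + l1) - (n + 2) = 0 := by
    refine (mul_eq_zero.mp ?_).resolve_left (sub_ne_zero.mpr h01)
    rw [fn] at h0 h1
    linear_combination h0 - h1
  have d02 : l0 ^ 2 + l0 * l2 + l2 ^ 2 - ((n : ℝ) - 1) * (l0 + l2) - (n + 2) = 0 := by
    refine (mul_eq_zero.mp ?_).resolve_left (sub_ne_zero.mpr h02)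
    rw [fn] at h0 h2
    linear_combination h0 - h2
  have e : l0 + l1 + l2 - ((n : ℝ) - 1) = 0 := by
    refine (mul_eq_zero.mp ?_).resolve_left (sub_ne_zero.mpr h12)
    linear_combination d01 - d02
  rw [fn] at *
  linear_combination h0 + (X - l0) * d01 + (X - l0) * (X - l1) * e

theorem IsRoots.exists_pos {n : ℤ} {l0 l1 l2 : ℝ} (h : IsRoots n l0 l1 l2) :
    0 < l0 ∨ 0 < l1 ∨ 0 < l2 := by
  have h0 := h.fn_eq 0
  rw [fn] at h0
  by_contra! hc
  obtain ⟨a, b, c⟩ := hc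
  have := mul_nonneg_of_nonpos_of_nonpos a b
  have := mul_nonpos_of_nonneg_of_nonpos this c
  nlinarith

theorem IsRoots.Fna_eq {n : ℤ} {l0 l1 l2 : ℝ} (h : IsRoots n l0 l1 l2) (hl : 0 < l0)
    (a : ℤ) (x y : ℝ) :
    Fna a l0 l1 l2 x y = Fna a l0 (-1 / (1 + l0)) (-(1 + 1 / l0)) x y := by
  have hu := fn_eq_mul hl h.1 l1
  have hv := fn_eq_mul hl h.1 l2
  obtain ⟨-, h1, h2, h01, h02, h12⟩ := h
  rw [h1, eq_comm, mul_eq_zero, mul_eq_zero, sub_eq_zero, sub_eq_zero, sub_eq_zero] at hu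
  rw [h2, eq_comm, mul_eq_zero, mul_eq_zero, sub_eq_zero, sub_eq_zero, sub_eq_zero] at hv
  rcases hu with (hu | hu) | hu
  · exact absurd hu.symm h01
  · rcases hv with (hv | hv) | hv
    · exact absurd hv.symm h02
    · exact absurd (hu.trans hv.symm) h12
    · rw [hu, hv]
  · rcases hv with (hv | hv) | hv
    · exact absurd hv.symm h02
    · rw [hu, hv, Fna, Fna]
      ring
    · exact absurd (hu.trans hv.symm) h12

theorem fn_root_bounds {n : ℤ} (hn : 0 ≤ n) {L : ℝ} (hL : 0 < L) (h : fn n L = 0) :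
    6 / 5 ≤ L ∧ n < L ∧ L < n + 2 := by
  have hn' : (0 : ℝ) ≤ n := by exact_mod_cast hn
  have key : (L - n) * (L ^ 2 + L) = 2 * L + 1 := by
    rw [fn] at h
    linear_combination h
  have hpos : 0 < L ^ 2 + L := by positivity
  have h1 : 6 / 5 ≤ L := by
    by_contra! hc
    have : L * (L ^ 2 + L) ≥ 2 * L + 1 := by nlinarith
    nlinarith [mul_pos hL hL, mul_pos hL (sub_pos.mpr hc)]
  refine ⟨h1, ?_, ?_⟩
  · have := pos_of_mul_pos_left (a := L - n) (by rw [key]; positivity) hpos.le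
    linarith
  · by_contra! hc
    nlinarith

theorem IsRoots.exists_root {n : ℤ} {l0 l1 l2 : ℝ} (h : IsRoots n l0 l1 l2) :
    ∃ L, 0 < L ∧ fn n L = 0 ∧ ∀ (a : ℤ) (x y : ℝ),
      Fna a l0 l1 l2 x y = Fna a L (-1 / (1 + L)) (-(1 + 1 / L)) x y := by
  rcases h.exists_pos with hl | hl | hl
  · exact ⟨l0, hl, h.1, h.Fna_eq hl⟩
  · have h' : IsRoots n l1 l0 l2 :=
      ⟨h.2.1, h.1, h.2.2.1, h.2.2.2.1.symm, h.2.2.2.2.2, h.2.2.2.2.1⟩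
    refine ⟨l1, hl, h'.1, fun a x y => ?_⟩
    rw [← h'.Fna_eq hl, Fna, Fna]
    ring
  · have h' : IsRoots n l2 l1 l0 :=
      ⟨h.2.2.1, h.2.1, h.1, h.2.2.2.2.2.symm, h.2.2.2.2.1.symm, h.2.2.2.1.symm⟩
    refine ⟨l2, hl, h'.1, fun a x y => ?_⟩
    rw [← h'.Fna_eq hl, Fna, Fna]
    ring

open Polynomial in
/-- `f_n` as a polynomial with integer coefficients. -/
def fnPoly (n : ℤ) : ℤ[X] := X ^ 3 - C (n - 1) * X ^ 2 - C (n + 2) * X - 1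

theorem aeval_fnPoly (n : ℤ) (t : ℝ) : Polynomial.aeval t (fnPoly n) = fn n t := by
  simp only [fnPoly, fn, map_sub, map_mul, map_pow, Polynomial.aeval_X, Polynomial.aeval_C, map_one]
  simp

theorem natDegree_fnPoly (n : ℤ) : (fnPoly n).natDegree = 3 := by
  rw [fnPoly]
  compute_degree!

theorem monic_fnPoly (n : ℤ) : (fnPoly n).Monic := by
  rw [fnPoly]
  monicity!

open Polynomial in
theorem irreducible_fnPoly (n : ℤ) : Irreducible (fnPoly n) := by
  rw [(monic_fnPoly n).irreducible_iff_roots_eq_zero_of_degree_le_three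
    (by rw [natDegree_fnPoly]; norm_num) (by rw [natDegree_fnPoly])]
  refine Multiset.eq_zero_of_forall_notMem fun t ht => ?_
  have ht : t ^ 3 - (n - 1) * t ^ 2 - (n + 2) * t - 1 = 0 := by
    simpa [fnPoly] using isRoot_of_mem_roots ht
  have hdvd : t ∣ 1 := ⟨t ^ 2 - (n - 1) * t - (n + 2), by linear_combination -ht⟩
  rcases Int.isUnit_iff.mp (isUnit_of_dvd_one hdvd) with rfl | rfl <;> omega

open Polynomial in
theorem one_le_abs_prod_aeval {n : ℤ} {l0 l1 l2 : ℝ}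
    (hf : ∀ X, fn n X = (X - l0) * (X - l1) * (X - l2)) {B : ℤ[X]} (hB : aeval l0 B ≠ 0) :
    1 ≤ |aeval l0 B * aeval l1 B * aeval l2 B| := by
  set φ := Int.castRingHom ℝ with hφ
  have hmap : (fnPoly n).map φ = (X - C l0) * (X - C l1) * (X - C l2) := by
    refine Polynomial.funext fun t => ?_
    have := aeval_fnPoly n t
    rw [hf, aeval_def, eval₂_eq_eval_map] at this
    simpa using this
  have hres : ((resultant (fnPoly n) B : ℤ) : ℝ) = aeval l0 B * aeval l1 B * aeval l2 B := by
    have hd : (B.map φ).natDegree ≤ B.natDegree := natDegree_map_le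
    have h12 : ((X - C l0) * (X - C l1)).natDegree = 2 := by
      rw [natDegree_mul (X_sub_C_ne_zero _) (X_sub_C_ne_zero _), natDegree_X_sub_C,
        natDegree_X_sub_C]
    have e1 := resultant_mul_left ((X - C l0) * (X - C l1)) (X - C l2) (B.map φ) _ hd
    have e2 := resultant_mul_left (X - C l0) (X - C l1) (B.map φ) _ hd
    simp only [h12, natDegree_X_sub_C, Nat.reduceAdd, resultant_X_sub_C_left _ _ _ hd] at e1 e2
    have e3 := resultant_map_map (fnPoly n) B 3 B.natDegree φ
    rw [hmap, e1, e2] at e3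
    rw [natDegree_fnPoly, aeval_def, aeval_def, aeval_def, eval₂_eq_eval_map, eval₂_eq_eval_map,
      eval₂_eq_eval_map]
    exact e3.symm
  have hne : resultant (fnPoly n) B ≠ 0 := by
    have hirr : Irreducible ((fnPoly n).map (Int.castRingHom ℚ)) :=
      ((monic_fnPoly n).irreducible_iff_irreducible_map_fraction_map (K := ℚ)).mp
        (irreducible_fnPoly n)
    have hcop : IsCoprime ((fnPoly n).map (Int.castRingHom ℚ)) (B.map (Int.castRingHom ℚ)) := by
      refine hirr.coprime_iff_not_dvd.mpr fun hdvd => hB ?_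
      obtain ⟨G, hG⟩ := hdvd
      have := congrArg (aeval l0) hG
      have hL0 : aeval l0 (fnPoly n) = 0 := by rw [aeval_fnPoly, hf]; simp
      rw [map_mul] at this
      have ea : ∀ p : ℤ[X], aeval l0 (p.map (Int.castRingHom ℚ)) = aeval l0 p := fun p =>
        aeval_map_algebraMap ℚ l0 p
      rwa [ea, ea, hL0, zero_mul] at this
    have h := resultant_ne_zero _ _ hcop
    rw [natDegree_map_eq_of_injective (Int.castRingHom ℚ).injective_int,
      natDegree_map_eq_of_injective (Int.castRingHom ℚ).injective_int, resultant_map_map] at h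
    exact fun h0 => h (by rw [h0]; simp)
  rw [← hres]
  exact_mod_cast Int.one_le_abs hne

open Polynomial in
theorem aeval_reflect {k : ℕ} {p : ℤ[X]} (hp : p.natDegree ≤ k) {t : ℝ} (ht : t ≠ 0) :
    aeval t (p.reflect k) = t ^ k * aeval (1 / t) p := by
  have ht' : (1 / t : ℝ) ≠ 0 := one_div_ne_zero ht
  let := invertibleOfNonzero ht'
  have h := eval₂_reflect_mul_pow (algebraMap ℤ ℝ) (1 / t) k p hp
  rw [invOf_eq_inv, one_div, inv_inv] at h
  rw [aeval_def, aeval_def, one_div, ← h, inv_pow]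
  field_simp

open Polynomial in
/-- A Padé approximant whose value at `1 / L` is distinct from `x / y` bounds the quality of the
approximation of `(1 + 1 / L) ^ a` by `x / y`. -/
theorem pow_le_of_pade {n : ℤ} {L : ℝ} (hL1 : 1 ≤ L) (hL : fn n L = 0)
    {a k : ℕ} (ha : 4 * k ≤ a) {x y : ℤ}
    (hx : |(x : ℝ)| ≤ 2 ^ a) (hy : |(y : ℝ)| ≤ 2 ^ a)
    (hd : (x - (1 + 1 / L) ^ a * y) ^ 2 * L ^ a ≤ 1)
    {P Q R : ℤ[X]} (h : Q * (1 + X) ^ a = P + X ^ (2 * k + 1) * R)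
    (hP : P.natDegree ≤ k) (hQ : Q.natDegree ≤ k) (hR : R.natDegree ≤ 2 * a)
    (hPc : ∀ i, |P.coeff i| ≤ 2 ^ (5 * a)) (hQc : ∀ i, |Q.coeff i| ≤ 2 ^ (5 * a))
    (hRc : ∀ i, |R.coeff i| ≤ 2 ^ (5 * a))
    (hne : (y : ℝ) * aeval (1 / L) P ≠ x * aeval (1 / L) Q) :
    L ^ k ≤ 2 ^ (27 * a) := by
  have hLpos : 0 < L := by linarith
  have hPc' : ∀ i, |(P.coeff i : ℝ)| ≤ 2 ^ (5 * a) := fun i => by exact_mod_cast hPc i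
  have hQc' : ∀ i, |(Q.coeff i : ℝ)| ≤ 2 ^ (5 * a) := fun i => by exact_mod_cast hQc i
  have hRc' : ∀ i, |(R.coeff i : ℝ)| ≤ 2 ^ (5 * a) := fun i => by exact_mod_cast hRc i
  have h2a : ∀ m : ℕ, (m : ℝ) + 1 ≤ 2 ^ m := fun m => by
    exact_mod_cast Nat.lt_two_pow_self (n := m)
  have h2mono : ∀ {i j : ℕ}, i ≤ j → (2 : ℝ) ^ i ≤ 2 ^ j := fun hij =>
    pow_le_pow_right₀ one_le_two hij
  set z := 1 / L with hz
  have hz0 : 0 < z := by positivity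
  have hz1 : z ≤ 1 := by rw [hz, div_le_one hLpos]; exact hL1
  have hzabs : |z| ≤ 1 := by rwa [abs_of_pos hz0]
  have hLz : L * z = 1 := by rw [hz]; field_simp
  set E : ℤ[X] := C y * P - C x * Q with hE
  have hEdeg : E.natDegree ≤ k := (natDegree_sub_le _ _).trans
    (max_le ((natDegree_C_mul_le _ _).trans hP) ((natDegree_C_mul_le _ _).trans hQ))
  have hEz : aeval z E = y * aeval z P - x * aeval z Q := by simp [hE]
  set B := E.reflect k with hB
  have hBdeg : B.natDegree ≤ k := natDegree_reflect_le.trans (max_le le_rfl hEdeg)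
  have hBL : aeval L B = L ^ k * aeval z E := aeval_reflect hEdeg hLpos.ne'
  have hBL0 : aeval L B ≠ 0 := by
    rw [hBL, hEz]
    exact mul_ne_zero (by positivity) (sub_ne_zero.mpr hne)
  have hBc : ∀ i, |(B.coeff i : ℝ)| ≤ 2 ^ (6 * a + 1) := by
    intro i
    rw [hB, coeff_reflect, hE, coeff_sub, coeff_C_mul, coeff_C_mul]
    push_cast
    refine (abs_sub _ _).trans ?_
    rw [abs_mul, abs_mul]
    have h1 := mul_le_mul hy (hPc' (revAt k i)) (abs_nonneg _) (by positivity)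
    have h2 := mul_le_mul hx (hQc' (revAt k i)) (abs_nonneg _) (by positivity)
    calc _ ≤ (2 : ℝ) ^ a * 2 ^ (5 * a) + 2 ^ a * 2 ^ (5 * a) := add_le_add h1 h2
      _ = _ := by ring
  have hconj : ∀ t : ℝ, |t| ≤ 2 → |aeval t B| ≤ 2 ^ (8 * a + 1) := by
    intro t ht
    refine (abs_aeval_le hBdeg hBc one_le_two ht).trans ?_
    calc _ ≤ (2 : ℝ) ^ k * (2 ^ (6 * a + 1) * 2 ^ k) :=
          mul_le_mul_of_nonneg_right (h2a k) (by positivity)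
      _ = 2 ^ (6 * a + 1 + 2 * k) := by ring
      _ ≤ _ := h2mono (by omega)
  have hQz : |aeval z Q| ≤ 2 ^ (6 * a) := by
    refine (abs_aeval_le hQ hQc' le_rfl hzabs).trans ?_
    calc _ ≤ (2 : ℝ) ^ k * (2 ^ (5 * a) * 1 ^ k) :=
          mul_le_mul_of_nonneg_right (h2a k) (by positivity)
      _ = 2 ^ (5 * a + k) := by rw [one_pow]; ring
      _ ≤ _ := h2mono (by omega)
  have hRz : |aeval z R| ≤ 2 ^ (7 * a) := by
    refine (abs_aeval_le hR hRc' le_rfl hzabs).trans ?_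
    calc _ ≤ (2 : ℝ) ^ (2 * a) * (2 ^ (5 * a) * 1 ^ (2 * a)) :=
          mul_le_mul_of_nonneg_right (h2a (2 * a)) (by positivity)
      _ = 2 ^ (7 * a) := by rw [one_pow]; ring
  have hid : aeval z Q * (1 + z) ^ a = aeval z P + z ^ (2 * k + 1) * aeval z R := by
    have := congrArg (aeval z) h
    simpa using this
  have hmain : aeval L B * L ^ k =
      aeval z Q * ((1 + z) ^ a * y - x) * L ^ (2 * k) - y * z * aeval z R := by
    have hz2 : L ^ (2 * k) * z ^ (2 * k) = 1 := by rw [← mul_pow, hLz, one_pow]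
    rw [hBL, hEz]
    linear_combination (-(L ^ (2 * k) * y)) * hid - y * z * aeval z R * hz2
  have hdelta : |((1 + z) ^ a * y - x) * L ^ (2 * k)| ≤ 1 := by
    rw [← sq_le_one_iff_abs_le_one]
    calc _ = (x - (1 + z) ^ a * y) ^ 2 * L ^ (4 * k) := by ring
      _ ≤ (x - (1 + z) ^ a * y) ^ 2 * L ^ a :=
        mul_le_mul_of_nonneg_left (pow_le_pow_right₀ hL1 ha) (sq_nonneg _)
      _ ≤ 1 := hd
  have hBLle : |aeval L B| * L ^ k ≤ 2 ^ (8 * a + 1) := by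
    rw [← abs_of_pos (pow_pos hLpos k), ← abs_mul, hmain]
    refine (abs_sub _ _).trans ?_
    rw [mul_assoc, abs_mul (aeval z Q), abs_mul (y * z), abs_mul (y : ℝ)]
    have h1 := mul_le_mul hQz hdelta (abs_nonneg _) (by positivity)
    have h2 := mul_le_mul (mul_le_mul hy hzabs (abs_nonneg _) (by positivity)) hRz (abs_nonneg _)
      (by positivity)
    have h3 : (2 : ℝ) ^ (6 * a) ≤ 2 ^ (8 * a) := h2mono (by omega)
    calc _ ≤ (2 : ℝ) ^ (6 * a) * 1 + 2 ^ a * 1 * 2 ^ (7 * a) := add_le_add h1 h2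
      _ = 2 ^ (6 * a) + 2 ^ (8 * a) := by ring
      _ ≤ 2 ^ (8 * a) + 2 ^ (8 * a) := by linarith
      _ = _ := by ring
  have hprod := one_le_abs_prod_aeval (fn_eq_mul hLpos hL) hBL0
  have hu : |-1 / (1 + L)| ≤ 2 := by
    rw [abs_div, abs_neg, abs_one, abs_of_pos (by linarith), div_le_iff₀ (by linarith)]
    linarith
  have hv : |-(1 + z)| ≤ 2 := by
    rw [abs_neg, abs_of_pos (by linarith)]
    linarith
  rw [abs_mul, abs_mul] at hprod
  have ha1 : a = 0 ∨ 1 ≤ a := by omega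
  rcases ha1 with rfl | ha1
  · have hk : k = 0 := by omega
    simp [hk]
  calc L ^ k = 1 * L ^ k := (one_mul _).symm
    _ ≤ |aeval L B| * |aeval (-1 / (1 + L)) B| * |aeval (-(1 + z)) B| * L ^ k :=
      mul_le_mul_of_nonneg_right hprod (by positivity)
    _ = |aeval L B| * L ^ k * (|aeval (-1 / (1 + L)) B| * |aeval (-(1 + z)) B|) := by ring
    _ ≤ 2 ^ (8 * a + 1) * (2 ^ (8 * a + 1) * 2 ^ (8 * a + 1)) := by
      refine mul_le_mul hBLle ?_ (by positivity) (by positivity)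
      exact mul_le_mul (hconj _ hu) (hconj _ hv) (abs_nonneg _) (by positivity)
    _ = 2 ^ (24 * a + 3) := by ring
    _ ≤ 2 ^ (27 * a) := h2mono (by omega)

theorem not_close_approx {n : ℤ} {L : ℝ} (hL : fn n L = 0) (hL2 : 2 ^ 217 ≤ L)
    {a : ℕ} (ha : 16 ≤ a) {x y : ℤ} (hy0 : y ≠ 0)
    (hx : |(x : ℝ)| ≤ 2 ^ a) (hy : |(y : ℝ)| ≤ 2 ^ a) :
    1 < (x - (1 + 1 / L) ^ a * y) ^ 2 * L ^ a := by
  by_contra! hd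
  have hL1 : 1 ≤ L := le_trans (by norm_num) hL2
  have big : ∀ k : ℕ, 1 ≤ k → a ≤ 8 * k → ¬ L ^ k ≤ 2 ^ (27 * a) := by
    intro k hk hak h
    have h1 : ((2 : ℝ) ^ 217) ^ k ≤ L ^ k := pow_le_pow_left₀ (by positivity) hL2 k
    have h2 : (2 : ℝ) ^ (217 * k) ≤ 2 ^ (27 * a) := by
      rw [pow_mul]; exact h1.trans h
    have := (pow_le_pow_iff_right₀ (one_lt_two (α := ℝ))).mp h2
    omega
  obtain ⟨k, hk⟩ : ∃ k, k + 1 = a / 4 := ⟨a / 4 - 1, by omega⟩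
  obtain ⟨P, Q, R, h, hP, hQ, hR, hPc, hQc, hRc, -, hR0⟩ :=
    exists_pade (a := a) (k := k) (by omega) (by omega)
  obtain ⟨P', Q', R', h', hP', hQ', hR', hPc', hQc', hRc', hQ0', -⟩ :=
    exists_pade (a := a) (k := k + 1) (by omega) (by omega)
  have hdet := pade_det_ne_zero h h' hP hQ hP' hQ' hQ0' hR0 (z := 1 / L) (by positivity)
  have heq := not_imp_comm.mp (pow_le_of_pade hL1 hL (by omega) hx hy hd h hP hQ hR hPc hQc hRc)
    (big k (by omega) (by omega))
  have heq' := not_imp_comm.mp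
    (pow_le_of_pade hL1 hL (by omega) hx hy hd h' hP' hQ' hR' hPc' hQc' hRc')
    (big (k + 1) (by omega) (by omega))
  have hy0' : (y : ℝ) ≠ 0 := by exact_mod_cast hy0
  refine hdet (mul_left_cancel₀ hy0' ?_)
  linear_combination Polynomial.aeval (1 / L) Q' * heq - Polynomial.aeval (1 / L) Q * heq'

/-- If `|F_{n,a}(x, y)|`, `|x|` and `|y|` are small, then `(1 + 1 / L) ^ a` is close to `± x / y`. -/
theorem sq_mul_pow_le_one_of_Fna_le {L : ℝ} (hL : 6 / 5 ≤ L) {a : ℕ} {x y m E : ℝ}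
    (hx1 : 1 ≤ |x|) (hy1 : 1 ≤ |y|) (hE2 : 2 ≤ E) (hx : |x| ≤ E) (hy : |y| ≤ E)
    (hEa : E ^ 2 ≤ (6 / 5) ^ a) (hm : 16 * m ^ 2 ≤ L ^ a)
    (hF : |Fna (a : ℤ) L (-1 / (1 + L)) (-(1 + 1 / L)) x y| ≤ m) :
    (x - (1 + 1 / L) ^ a * ((-1) ^ a * y)) ^ 2 * L ^ a ≤ 1 := by
  have hLa : (6 / 5) ^ a ≤ L ^ a := pow_le_pow_left₀ (by norm_num) hL a
  have hLpos : 0 < L ^ a := by positivity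
  have h0 : L ^ a / 2 ≤ |x - L ^ a * y| := by
    have h1 : |L ^ a * y| - |x| ≤ |x - L ^ a * y| := by
      rw [abs_sub_comm]; exact abs_sub_abs_le_abs_sub _ _
    rw [abs_mul, abs_of_pos hLpos] at h1
    nlinarith
  have h1 : 1 / 2 ≤ |x - (-1 / (1 + L)) ^ a * y| := by
    have h2 : |x| - |(-1 / (1 + L)) ^ a * y| ≤ |x - (-1 / (1 + L)) ^ a * y| :=
      abs_sub_abs_le_abs_sub _ _
    have h3 : |(-1 / (1 + L)) ^ a| ≤ 1 / (6 / 5) ^ a := by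
      rw [abs_pow, ← one_div_pow]
      refine pow_le_pow_left₀ (abs_nonneg _) ?_ a
      rw [abs_div, abs_neg, abs_one, abs_of_pos (by linarith)]
      exact one_div_le_one_div_of_le (by norm_num) (by linarith)
    have h4 : |(-1 / (1 + L)) ^ a * y| ≤ 1 / 2 := by
      rw [abs_mul]
      refine (mul_le_mul h3 hy (abs_nonneg _) (by positivity)).trans ?_
      rw [one_div_mul_eq_div, div_le_div_iff₀ (by positivity) two_pos]
      nlinarith
    linarith
  set d := x - (1 + 1 / L) ^ a * ((-1) ^ a * y) with hd
  have hd' : x - (-(1 + 1 / L)) ^ a * y = d := by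
    rw [hd, neg_pow]; ring
  rw [Fna, zpow_natCast, zpow_natCast, zpow_natCast, hd', abs_mul, abs_mul] at hF
  have hprod : L ^ a / 2 * (1 / 2) * |d| ≤ m :=
    (mul_le_mul_of_nonneg_right (mul_le_mul h0 h1 (by norm_num) (abs_nonneg _))
      (abs_nonneg d)).trans hF
  have hsq : (L ^ a * |d|) ^ 2 ≤ (4 * m) ^ 2 :=
    pow_le_pow_left₀ (by positivity) (by linarith) 2
  rw [mul_pow, sq_abs] at hsq
  have : d ^ 2 * L ^ a * L ^ a ≤ 1 * L ^ a := by nlinarith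
  exact le_of_mul_le_mul_right this hLpos

theorem lt_abs_Fna {n : ℤ} (hn : 0 ≤ n) {L : ℝ} (hLpos : 0 < L) (hL : fn n L = 0) {a : ℕ}
    (ha : 16 ≤ a) {x y : ℤ} (hx0 : x ≠ 0) (hy0 : y ≠ 0) {m E : ℝ} (hE2 : 2 ≤ E)
    (hx : |(x : ℝ)| ≤ E) (hy : |(y : ℝ)| ≤ E) (hEa : E ^ 2 ≤ (6 / 5) ^ a)
    (hm : 16 * m ^ 2 ≤ L ^ a) (hEL : L < 2 ^ 217 → E ^ 2 ≤ (1 + 1 / L) ^ a) :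
    m < |Fna (a : ℤ) L (-1 / (1 + L)) (-(1 + 1 / L)) x y| := by
  by_contra! hF
  obtain ⟨hL1, -, -⟩ := fn_root_bounds hn hLpos hL
  have hx1 : (1 : ℝ) ≤ |(x : ℝ)| := by exact_mod_cast Int.one_le_abs hx0
  have hy1 : (1 : ℝ) ≤ |(y : ℝ)| := by exact_mod_cast Int.one_le_abs hy0
  have hd := sq_mul_pow_le_one_of_Fna_le hL1 hx1 hy1 hE2 hx hy hEa hm hF
  have hsign : |(-1 : ℝ) ^ a * y| = |(y : ℝ)| := by rw [abs_mul, abs_pow]; simp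
  by_cases hbig : 2 ^ 217 ≤ L
  · have hE : E ≤ 2 ^ a := by
      have : ((6 : ℝ) / 5) ^ a ≤ 2 ^ a := pow_le_pow_left₀ (by norm_num) (by norm_num) a
      nlinarith
    have hlt := not_close_approx hL hbig ha (x := x) (y := (-1) ^ a * y)
      (mul_ne_zero (by simp) hy0) (hx.trans hE)
      (by push_cast; rw [hsign]; exact hy.trans hE)
    push_cast at hlt
    linarith
  · have hEθ := hEL (not_le.mp hbig)
    set w := (1 + 1 / L) ^ a * ((-1) ^ a * (y : ℝ)) with hw
    have hwabs : |w| = (1 + 1 / L) ^ a * |(y : ℝ)| := by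
      rw [hw, abs_mul, hsign, abs_of_pos (by positivity)]
    have h1 : |w| - |(x : ℝ)| ≤ |x - w| := by
      rw [abs_sub_comm]; exact abs_sub_abs_le_abs_sub _ _
    have h2 : 2 ≤ |x - w| := by
      rw [hwabs] at h1
      nlinarith
    have h3 : 1 ≤ L ^ a := one_le_pow₀ (by linarith)
    have h4 : (2 : ℝ) ^ 2 ≤ (x - w) ^ 2 := by
      rw [← sq_abs (x - w)]
      exact pow_le_pow_left₀ (by norm_num) h2 2
    nlinarith

theorem exp_mul_natCast_le_pow {c b : ℝ} (hb : 0 < b) (h : c ≤ Real.log b) (a : ℕ) :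
    Real.exp (c * a) ≤ b ^ a := by
  rw [← Real.exp_log (pow_pos hb a), Real.log_pow, Real.exp_le_exp, mul_comm]
  exact mul_le_mul_of_nonneg_left h (Nat.cast_nonneg a)

theorem log_add_two_le {n : ℤ} (hn : 0 ≤ n) {L : ℝ} (hL : 6 / 5 ≤ L) (hnL : n < L) :
    Real.log ((n : ℝ) + 2) ≤ 7 * Real.log L := by
  have hn' : (0 : ℝ) ≤ n := by exact_mod_cast hn
  have h : (n : ℝ) + 2 ≤ L ^ 7 := by
    have h6 : (6 / 5 : ℝ) ^ 6 ≤ L ^ 6 := pow_le_pow_left₀ (by norm_num) hL 6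
    have : L ^ 7 = L ^ 6 * L := by ring
    norm_num at h6
    nlinarith
  calc Real.log ((n : ℝ) + 2) ≤ Real.log (L ^ 7) := Real.log_le_log (by linarith) h
    _ = _ := by rw [Real.log_pow]; norm_num

theorem one_div_le_log_log {n : ℤ} (hn : 0 ≤ n) :
    1 / 32 ≤ Real.log (Real.log ((n : ℝ) + 3)) := by
  have hn' : (0 : ℝ) ≤ n := by exact_mod_cast hn
  have h3 := Real.log_three_gt_d9
  have h1 : 1.09 ≤ Real.log ((n : ℝ) + 3) :=
    le_trans (by linarith) (Real.log_le_log (by norm_num) (by linarith : (3 : ℝ) ≤ n + 3))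
  have h2 := Real.one_sub_inv_le_log_of_pos (x := 1.09) (by norm_num)
  have h4 := Real.log_le_log (by norm_num) h1
  norm_num at h2
  linarith

theorem one_div_le_log_of_le {b c : ℝ} (hc : 1 + 1 / c ≤ b) (hc0 : 0 < c) :
    1 / (c + 1) ≤ Real.log b := by
  have h := Real.one_sub_inv_le_log_of_pos (x := 1 + 1 / c) (by positivity)
  have h2 := Real.log_le_log (by positivity) hc
  have h3 : 1 - (1 + 1 / c)⁻¹ = 1 / (c + 1) := by field_simp; ring
  linarith

theorem lt_abs_Fna_of_log_le {n : ℤ} (hn : 0 ≤ n) {L : ℝ} (hLpos : 0 < L) (hL : fn n L = 0)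
    {a : ℕ} {x y : ℤ} (hx0 : x ≠ 0) (hy0 : y ≠ 0) {m : ℝ} (hm0 : 0 < m)
    (ha : 2 ^ 219 ≤ (a : ℝ)) (hx : Real.log |(x : ℝ)| ≤ 1 / 2 ^ 219 * a)
    (hy : Real.log |(y : ℝ)| ≤ 1 / 2 ^ 219 * a)
    (hm : Real.log m ≤ 1 / 2 ^ 219 * a * Real.log ((n : ℝ) + 2)) :
    m < |Fna (a : ℤ) L (-1 / (1 + L)) (-(1 + 1 / L)) x y| := by
  obtain ⟨hL1, hnL, -⟩ := fn_root_bounds hn hLpos hL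
  set t : ℝ := 1 / 2 ^ 219 * a with ht
  have ht1 : 1 ≤ t := by
    rw [ht, one_div_mul_eq_div, le_div_iff₀ (by positivity)]
    linarith
  have hsq : Real.exp t ^ 2 = Real.exp (2 / 2 ^ 219 * a) := by
    rw [← Real.exp_nat_mul, ht]
    congr 1
    push_cast
    ring
  have habs : ∀ {w : ℤ}, w ≠ 0 → Real.log |(w : ℝ)| ≤ t → |(w : ℝ)| ≤ Real.exp t :=
    fun hw h => (Real.log_le_iff_le_exp (by positivity)).mp h
  have hlog65 := one_div_le_log_of_le (b := 6 / 5) (c := 5) (by norm_num) (by norm_num)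
  refine lt_abs_Fna hn hLpos hL (E := Real.exp t) ?_ hx0 hy0 ?_ (habs hx0 hx) (habs hy0 hy)
    ?_ ?_ ?_
  · have : (16 : ℝ) ≤ a := le_trans (by norm_num) ha
    exact_mod_cast this
  · have := Real.add_one_le_exp t
    linarith
  · rw [hsq]
    exact exp_mul_natCast_le_pow (by norm_num) (le_trans (by norm_num) hlog65) a
  · have hlogL : 1 / 6 ≤ Real.log L := le_trans (by norm_num)
      (hlog65.trans (Real.log_le_log (by norm_num) hL1))
    have hm' : Real.log m ≤ t * (7 * Real.log L) :=
      hm.trans (mul_le_mul_of_nonneg_left (log_add_two_le hn hL1 hnL) (by linarith))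
    have h16 : Real.log 16 ≤ 4 * t := by
      have : Real.log 16 = 4 * Real.log 2 := by
        rw [show (16 : ℝ) = 2 ^ 4 by norm_num, Real.log_pow]; norm_num
      have := Real.log_two_lt_d9
      linarith
    rw [← Real.log_le_log_iff (by positivity) (by positivity), Real.log_mul (by norm_num)
      (by positivity), Real.log_pow, Real.log_pow]
    have hat : 38 * t ≤ a := by
      rw [ht]
      have : (0 : ℝ) ≤ a := Nat.cast_nonneg a
      nlinarith
    push_cast
    nlinarith
  · intro hsmall
    rw [hsq]
    refine exp_mul_natCast_le_pow (by positivity) ?_ a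
    refine le_trans ?_ (one_div_le_log_of_le (c := 2 ^ 217) ?_ (by positivity))
    · norm_num
    · have := one_div_le_one_div_of_le hLpos hsmall.le
      linarith

theorem stmt3 :
    ∃ C : ℝ, 0 < C ∧ ∀ (n a m x y : ℤ) (l0 l1 l2 : ℝ), IsRoots n l0 l1 l2 →
      0 ≤ n → 1 ≤ a → 1 ≤ m → x * y ≠ 0 →
      0 < |Fna a l0 l1 l2 (x : ℝ) (y : ℝ)| →
      |Fna a l0 l1 l2 (x : ℝ) (y : ℝ)| ≤ (m : ℝ) →
      (a : ℝ) ≤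
        C * max (max 1 ((1 + Real.log |(x : ℝ)|) * Real.log (Real.log ((n : ℝ) + 3))))
                (max (Real.log |(y : ℝ)|) (Real.log (m : ℝ) / Real.log ((n : ℝ) + 2))) := by
  refine ⟨2 ^ 224, by positivity, ?_⟩
  intro n a m x y l0 l1 l2 hroots hn ha hm hxy _ hF
  obtain ⟨L, hLpos, hL, hFna⟩ := hroots.exists_root
  lift a to ℕ using by omega
  rw [hFna] at hF
  by_contra! hlt
  refine absurd hF (not_le.mpr ?_)
  set u := (1 + Real.log |(x : ℝ)|) * Real.log (Real.log ((n : ℝ) + 3)) with hu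
  set v := Real.log (m : ℝ) / Real.log ((n : ℝ) + 2) with hv
  have hx0 := left_ne_zero_of_mul hxy
  have hy0 := right_ne_zero_of_mul hxy
  have hlogx : 0 ≤ Real.log |(x : ℝ)| :=
    Real.log_nonneg (by exact_mod_cast Int.one_le_abs hx0)
  have hn' : (0 : ℝ) ≤ n := by exact_mod_cast hn
  have hlogn : 0 < Real.log ((n : ℝ) + 2) := Real.log_pos (by linarith)
  have hle : ∀ w : ℝ, w ≤ max (max 1 u) (max (Real.log |(y : ℝ)|) v) → 2 ^ 224 * w ≤ a :=
    fun w hw => (mul_le_mul_of_nonneg_left hw (by positivity)).trans (by exact_mod_cast hlt.le)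
  have h1 := hle 1 (le_max_of_le_left (le_max_left _ _))
  have h2 := hle u (le_max_of_le_left (le_max_right _ _))
  have h3 := hle _ (le_max_of_le_right (le_max_left _ _))
  have h4 := hle v (le_max_of_le_right (le_max_right _ _))
  have hux : Real.log |(x : ℝ)| ≤ 32 * u := by
    have := one_div_le_log_log hn
    rw [hu]
    nlinarith
  have ha0 : (0 : ℝ) ≤ a := Nat.cast_nonneg a
  refine lt_abs_Fna_of_log_le hn hLpos hL hx0 hy0 (by exact_mod_cast hm) ?_ ?_ ?_ ?_
  · linarith
  · rw [one_div_mul_eq_div, le_div_iff₀ (by positivity)]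
    linarith
  · rw [one_div_mul_eq_div, le_div_iff₀ (by positivity)]
    linarith
  · rw [← div_le_iff₀ hlogn, ← hv, one_div_mul_eq_div, le_div_iff₀ (by positivity)]
    linarith
end
end

section
/- Let n ≥ 0 and a ≥ 1 be integers. There exist infinitely many pairs (x, y) ∈ ℤ² with y > 0 such that |F_{n,a}(x, y)| ≤ y·(n+4)^a. -/
noncomputable section

/-- A power `u ^ m`, `m ≠ 0`, of a real algebraic integer `u` with `0 < |u| < 1` is irrational. -/
theorem irrational_pow_of_isIntegral {u : ℝ} (hu : IsIntegral ℤ u) (hu0 : u ≠ 0) (hu1 : |u| < 1)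
    {m : ℕ} (hm : m ≠ 0) : Irrational (u ^ m) := by
  rintro ⟨q, hq⟩
  have hq' : IsIntegral ℤ (algebraMap ℚ ℝ q) := by
    have : algebraMap ℚ ℝ q = u ^ m := by simpa using hq
    rw [this]
    exact hu.pow m
  rw [isIntegral_algebraMap_iff (algebraMap ℚ ℝ).injective,
    IsIntegrallyClosed.isIntegral_iff] at hq'
  obtain ⟨z, rfl⟩ := hq'
  have hz : (z : ℝ) = u ^ m := by simpa using hq
  have hz1 : |(z : ℝ)| < 1 := by
    rw [hz, abs_pow]
    exact pow_lt_one₀ (abs_nonneg u) hu1 hm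
  have hz0 : z = 0 := Int.abs_lt_one_iff.mp (by exact_mod_cast hz1)
  exact pow_ne_zero m hu0 (by rw [← hz, hz0, Int.cast_zero])

open Polynomial in
theorem isIntegral_of_fn_eq_zero {n : ℤ} {u : ℝ} (h : fn n u = 0) : IsIntegral ℤ u := by
  refine ⟨X ^ 3 - C (n - 1) * X ^ 2 - C (n + 2) * X - 1, by monicity!, ?_⟩
  simp only [eval₂_sub, eval₂_mul, eval₂_C, eval₂_X_pow, eval₂_X, eval₂_one]
  simpa [fn] using h

/-- An irrational number has infinitely many rational approximations satisfying Dirichlet's bound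
inside any prescribed neighbourhood. -/
theorem infinite_rat_abs_sub_lt_of_irrational {ξ : ℝ} (hξ : Irrational ξ) {ε : ℝ} (hε : 0 < ε) :
    {q : ℚ | |ξ - q| < 1 / (q.den : ℝ) ^ 2 ∧ |ξ - q| < ε}.Infinite := by
  intro hfin
  obtain ⟨r, hr₁, hr₂⟩ := exists_rat_btwn (show ξ < ξ + ε by linarith)
  have hr : |ξ - r| < ε := by rw [abs_lt]; constructor <;> linarith
  obtain ⟨s, hs, hsr⟩ := Real.exists_rat_abs_sub_lt_and_lt_of_irrational hξ r
  obtain ⟨q, hq, hmin⟩ := Set.exists_min_image _ (fun q : ℚ => |ξ - q|) hfin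
    ⟨s, hs, hsr.trans hr⟩
  obtain ⟨q', hq', hlt⟩ := Real.exists_rat_abs_sub_lt_and_lt_of_irrational hξ q
  exact (hmin q' ⟨hq', hlt.trans hq.2⟩).not_gt hlt

/-- Dirichlet approximations `x / y` of `ξ` make the cubic `(x - ξ y) (x - β y) (x - γ y)` at most
`c y`, for any `c` larger than `|ξ - β| |ξ - γ|`. -/
theorem infinite_abs_cubic_le {ξ β γ c : ℝ} (hξ : Irrational ξ) (hc : |ξ - β| * |ξ - γ| < c) :
    {p : ℤ × ℤ | 0 < p.2 ∧
      |((p.1 : ℝ) - ξ * p.2) * (p.1 - β * p.2) * (p.1 - γ * p.2)| ≤ p.2 * c}.Infinite := by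
  have hcont : ContinuousAt (fun x : ℝ => |x - β| * |x - γ|) ξ := by fun_prop
  obtain ⟨ε, hε, hball⟩ := Metric.eventually_nhds_iff.mp (hcont.eventually_lt_const hc)
  have hinj : Function.Injective fun q : ℚ => (q.num, (q.den : ℤ)) := fun q r h => by
    simp only [Prod.mk.injEq, Nat.cast_inj] at h
    exact Rat.ext h.1 h.2
  refine ((infinite_rat_abs_sub_lt_of_irrational hξ hε).image hinj.injOn).mono ?_
  rintro _ ⟨q, ⟨hq₁, hq₂⟩, rfl⟩
  refine ⟨Int.natCast_pos.mpr q.den_pos, ?_⟩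
  have hd : (0 : ℝ) < q.den := Nat.cast_pos.mpr q.den_pos
  have hnum : (q.num : ℝ) = q * q.den := by exact_mod_cast (Rat.mul_den_eq_num q).symm
  have hq₃ : |(q : ℝ) - β| * |(q : ℝ) - γ| < c :=
    hball (by rwa [Real.dist_eq, abs_sub_comm])
  rw [lt_div_iff₀ (by positivity), abs_sub_comm] at hq₁
  simp only [Int.cast_natCast, hnum, ← sub_mul, abs_mul, abs_of_pos hd]
  calc |(q : ℝ) - ξ| * q.den * (|(q : ℝ) - β| * q.den) * (|(q : ℝ) - γ| * q.den)
      = (|(q : ℝ) - ξ| * (q.den : ℝ) ^ 2) * (q.den * (|(q : ℝ) - β| * |(q : ℝ) - γ|)) := by ring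
    _ ≤ 1 * (q.den * c) := by gcongr
    _ = q.den * c := one_mul _

theorem abs_pow_sub_pow_le_add_pow (x y : ℝ) {m : ℕ} (hm : m ≠ 0) : |x ^ m - y ^ m| ≤ (|x| + |y|) ^ m :=
  calc |x ^ m - y ^ m| ≤ |x ^ m| + |y ^ m| := abs_sub _ _
    _ = |x| ^ m + |y| ^ m := by simp only [abs_pow]
    _ ≤ (|x| + |y|) ^ m := pow_add_pow_le (abs_nonneg x) (abs_nonneg y) hm

/-- `f_n` has a root `t ≥ 1` small enough for the approximation argument at `-1 / (t + 1)`. -/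
theorem exists_root_fn {n : ℤ} (hn : 0 ≤ n) :
    ∃ t : ℝ, 1 ≤ t ∧ fn n t = 0 ∧ t + 2 + 1 / (t * (t + 1)) + 1 / (t + 1) ^ 2 < n + 4 := by
  have hcont : Continuous (fn n) := by unfold fn; fun_prop
  have ivt {b c : ℝ} (hbc : b ≤ c) (hb : fn n b ≤ 0) (hc : 0 ≤ fn n c) :
      ∃ t ∈ Set.Icc b c, fn n t = 0 :=
    intermediate_value_Icc hbc hcont.continuousOn ⟨hb, hc⟩
  have bound {b t : ℝ} (hb : 0 < b) (hbt : b ≤ t) :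
      1 / (t * (t + 1)) + 1 / (t + 1) ^ 2 ≤ 1 / (b * (b + 1)) + 1 / (b + 1) ^ 2 := by
    have := hb.trans_le hbt
    gcongr
  rcases hn.eq_or_lt with rfl | hn
  · obtain ⟨t, ⟨h₁, h₂⟩, ht⟩ := @ivt (6 / 5) (5 / 4) (by norm_num) (by norm_num [fn])
      (by norm_num [fn])
    have := bound (by norm_num) h₁
    norm_num at this
    refine ⟨t, by linarith, ht, ?_⟩
    norm_num
    linarith
  · have hn' : (1 : ℝ) ≤ n := by exact_mod_cast hn
    obtain ⟨t, ⟨h₁, h₂⟩, ht⟩ := @ivt 1 (n + 1) (by linarith) (by unfold fn; linarith)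
      (by unfold fn; nlinarith)
    have := bound one_pos h₁
    refine ⟨t, h₁, ht, ?_⟩
    norm_num at this ⊢
    linarith

theorem fn_eq_prod {n : ℤ} {t : ℝ} (ht : 1 ≤ t) (h : fn n t = 0) (x : ℝ) :
    fn n x = (x - -(1 / (t + 1))) * (x - t) * (x - -((t + 1) / t)) := by
  have ht0 : t ≠ 0 := by positivity
  have ht1 : t + 1 ≠ 0 := by positivity
  have hn : (n : ℝ) = (t ^ 3 + t ^ 2 - 2 * t - 1) / (t * (t + 1)) := by
    rw [eq_div_iff (by positivity)]
    unfold fn at h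
    linarith
  unfold fn
  rw [hn]
  field_simp
  ring

theorem infinite_Fna_le {n : ℤ} {m : ℕ} (hm : m ≠ 0) {t : ℝ} (ht : 1 ≤ t) (h : fn n t = 0)
    (hbound : t + 2 + 1 / (t * (t + 1)) + 1 / (t + 1) ^ 2 < n + 4) :
    {p : ℤ × ℤ | 0 < p.2 ∧ |Fna m (-(1 / (t + 1))) t (-((t + 1) / t)) (p.1 : ℝ) (p.2 : ℝ)| ≤
      (p.2 : ℝ) * ((n : ℝ) + 4) ^ m}.Infinite := by
  have ht0 : 0 < t := by positivity
  set u : ℝ := -(1 / (t + 1)) with hu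
  set v : ℝ := -((t + 1) / t) with hv
  have hu' : |u| = 1 / (t + 1) := by rw [hu, abs_neg, abs_of_pos (by positivity)]
  have hv' : |v| = (t + 1) / t := by rw [hv, abs_neg, abs_of_pos (by positivity)]
  have hroot : fn n u = 0 := by rw [fn_eq_prod ht h, ← hu, sub_self, zero_mul, zero_mul]
  have hirr : Irrational (u ^ m) := by
    refine irrational_pow_of_isIntegral (isIntegral_of_fn_eq_zero hroot) ?_ ?_ hm
    · rw [← abs_pos, hu']; positivity
    · rw [hu', div_lt_one (by positivity)]; linarith
  have hprod : (|u| + |t|) * (|u| + |v|) < n + 4 := by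
    rw [hu', hv', abs_of_pos ht0]
    convert hbound using 1
    field_simp
    ring
  have hc : |u ^ m - t ^ m| * |u ^ m - v ^ m| < ((n : ℝ) + 4) ^ m :=
    calc |u ^ m - t ^ m| * |u ^ m - v ^ m| ≤ (|u| + |t|) ^ m * (|u| + |v|) ^ m :=
          mul_le_mul (abs_pow_sub_pow_le_add_pow _ _ hm) (abs_pow_sub_pow_le_add_pow _ _ hm) (abs_nonneg _)
            (by positivity)
      _ = ((|u| + |t|) * (|u| + |v|)) ^ m := (mul_pow _ _ _).symm
      _ < _ := pow_lt_pow_left₀ hprod (by positivity) hm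
  simpa only [Fna, zpow_natCast] using infinite_abs_cubic_le hirr hc

/-- The form does not depend on the order in which the roots of `f_n` are listed. -/
theorem Fna_eq_of_isRoots {n : ℤ} {l0 l1 l2 u t v : ℝ} (hroots : IsRoots n l0 l1 l2)
    (hfac : ∀ x, fn n x = (x - u) * (x - t) * (x - v)) (a : ℤ) (x y : ℝ) :
    Fna a l0 l1 l2 x y = Fna a u t v x y := by
  obtain ⟨h0, h1, h2, h01, h02, h12⟩ := hroots
  simp only [hfac, mul_eq_zero, sub_eq_zero] at h0 h1 h2
  rcases h0 with (rfl | rfl) | rfl <;> rcases h1 with (rfl | rfl) | rfl <;>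
    rcases h2 with (rfl | rfl) | rfl <;> first | contradiction | (unfold Fna; ring)

theorem stmt4 (n a : ℤ) (hn : 0 ≤ n) (ha : 1 ≤ a) (l0 l1 l2 : ℝ)
    (hroots : IsRoots n l0 l1 l2) :
    {p : ℤ × ℤ | 0 < p.2 ∧
      |Fna a l0 l1 l2 (p.1 : ℝ) (p.2 : ℝ)| ≤ (p.2 : ℝ) * ((n : ℝ) + 4) ^ a}.Infinite := by
  obtain ⟨t, ht, h, hbound⟩ := exists_root_fn hn
  lift a to ℕ using by lia
  simp only [Fna_eq_of_isRoots hroots (fn_eq_prod ht h), zpow_natCast]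
  exact infinite_Fna_le (by lia) ht h hbound
end
end

section
/- Let n ≥ 0 and a ≥ 1 be integers and let ε > 0. There exist infinitely many pairs (x, y) ∈ ℤ² with y > 0 such that |F_{n,a}(x, y)| ≤ (1/2)·y·(1+ε)·|λ2^a − λ1^a|·|λ0^a − λ2^a|. -/
noncomputable section

/-- `l0 > 0 > l1 > −1 > l2` are the ordered real roots of `f_n`. -/
def IsOrderedRoots (n : ℤ) (l0 l1 l2 : ℝ) : Prop :=
  fn n l0 = 0 ∧ fn n l1 = 0 ∧ fn n l2 = 0 ∧ 0 < l0 ∧ l1 < 0 ∧ -1 < l1 ∧ l2 < -1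

open Filter Topology

/-- Neighbouring fractions around an irrational number, with arbitrarily large denominators. -/
lemma Irrational.exists_neighbours {α : ℝ} (hα : Irrational α) (k : ℕ) :
    ∃ p q r s : ℤ, 0 < q ∧ 0 < s ∧ r * q - p * s = 1 ∧ (p : ℝ) < α * q ∧ α * s < r ∧
      (k : ℤ) + 2 ≤ q + s := by
  induction k with
  | zero =>
    refine ⟨⌊α⌋, 1, ⌊α⌋ + 1, 1, one_pos, one_pos, by ring, ?_, ?_, by norm_num⟩
    · simpa using lt_of_le_of_ne (Int.floor_le α) (hα.ne_int ⌊α⌋).symm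
    · simp
  | succ k ih =>
    obtain ⟨p, q, r, s, hq, hs, hdet, hp, hr, hk⟩ := ih
    have hne : α * ((q + s : ℤ) : ℝ) ≠ ((p + r : ℤ) : ℝ) :=
      (hα.mul_intCast (by omega)).ne_int _
    push_cast at hne
    rcases lt_or_gt_of_ne hne with h | h
    · exact ⟨p, q, p + r, q + s, hq, by omega, by linear_combination hdet, hp,
        by push_cast; exact h, by push_cast; omega⟩
    · exact ⟨p + r, q + s, r, s, by omega, hs, by linear_combination hdet,
        by push_cast; exact h, hr, by push_cast; omega⟩

/-- **Vahlen's theorem**: an irrational number is a limit of fractions `p / q` at distance at most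
`1 / (2 q²)` from it. -/
lemma Irrational.exists_abs_mul_sub_le_half {α : ℝ} (hα : Irrational α) {U : Set ℝ}
    (hU : U ∈ 𝓝 α) :
    ∃ p q : ℤ, 0 < q ∧ (p / q : ℝ) ∈ U ∧ |α * q - p| * q ≤ 1 / 2 := by
  obtain ⟨δ, hδ, hball⟩ := Metric.mem_nhds_iff.mp hU
  obtain ⟨k, hk⟩ := exists_nat_gt (1 / δ)
  obtain ⟨p, q, r, s, hq, hs, hdet, hp, hr, hks⟩ := hα.exists_neighbours k
  have hq1 : (1 : ℝ) ≤ q := by exact_mod_cast hq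
  have hs1 : (1 : ℝ) ≤ s := by exact_mod_cast hs
  have hdet' : (r : ℝ) * q - p * s = 1 := by exact_mod_cast hdet
  have hks' : (k : ℝ) + 2 ≤ q + s := by exact_mod_cast hks
  have hqs : 1 < δ * (q * s) := by
    rw [div_lt_iff₀ hδ] at hk
    nlinarith [mul_nonneg (sub_nonneg.2 hq1) (sub_nonneg.2 hs1)]
  have hsum : (α * q - p) * s + (r - α * s) * q = 1 := by linear_combination hdet'
  have hp' : 0 < α * q - p := sub_pos.2 hp
  have hr' : 0 < r - α * s := sub_pos.2 hr
  by_cases h : (α * q - p) * q ≤ 1 / 2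
  · refine ⟨p, q, hq, hball ?_, by rwa [abs_of_pos hp']⟩
    rw [Metric.mem_ball, Real.dist_eq, abs_lt]
    have : (p / q : ℝ) - α = -((α * q - p) / q) := by field_simp; ring
    rw [this, neg_lt_neg_iff, div_lt_iff₀ (by linarith)]
    refine ⟨?_, by have := div_pos hp' (by linarith : (0 : ℝ) < q); linarith⟩
    nlinarith [mul_pos hr' (by linarith : (0 : ℝ) < q)]
  · refine ⟨r, s, hs, hball ?_, ?_⟩
    · rw [Metric.mem_ball, Real.dist_eq, abs_lt]
      have : (r / s : ℝ) - α = (r - α * s) / s := by field_simp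
      rw [this, div_lt_iff₀ (by linarith)]
      refine ⟨by have := div_pos hr' (by linarith : (0 : ℝ) < s); linarith, ?_⟩
      nlinarith [mul_pos hp' (by linarith : (0 : ℝ) < s)]
    · rw [abs_sub_comm, abs_of_pos hr']
      by_contra! h'
      push Not at h
      have h1 := mul_lt_mul_of_pos_right h (by positivity : (0 : ℝ) < s * s)
      have h2 := mul_lt_mul_of_pos_right h' (by positivity : (0 : ℝ) < q * q)
      have h3 : (α * q - p) * q * (s * s) + (r - α * s) * s * (q * q) = q * s := by
        linear_combination (q * s : ℝ) * hsum
      nlinarith [sq_nonneg ((q : ℝ) - s)]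

/-- Positive powers of a real number `x` with `1 < |x|` whose inverse is an algebraic integer are
irrational. -/
lemma irrational_pow_of_isIntegral_inv {x : ℝ} (hx : IsIntegral ℤ x⁻¹) (hx1 : 1 < |x|) {m : ℕ}
    (hm : m ≠ 0) : Irrational (x ^ m) := by
  rintro ⟨t, ht⟩
  have hinv : ((t⁻¹ : ℚ) : ℝ) = (x ^ m)⁻¹ := by rw [← ht, Rat.cast_inv]
  have hint : IsIntegral ℤ t⁻¹ := by
    rw [← isIntegral_algebraMap_iff (B := ℝ) (algebraMap ℚ ℝ).injective, eq_ratCast, hinv,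
      ← inv_pow]
    exact hx.pow m
  obtain ⟨y, hy⟩ := IsIntegrallyClosed.isIntegral_iff.mp hint
  have hy' : (y : ℝ) = (x ^ m)⁻¹ := by rw [← hinv, ← hy]; simp
  have hxm : 1 < |x ^ m| := by rw [abs_pow]; exact one_lt_pow₀ hx1 hm
  have hlt : |(y : ℝ)| < 1 := by
    rw [hy', abs_inv]
    exact inv_lt_one_of_one_lt₀ hxm
  have hy0 : y = 0 := Int.abs_lt_one_iff.mp (by exact_mod_cast hlt)
  rw [hy0, Int.cast_zero, eq_comm, inv_eq_zero] at hy'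
  rw [hy', abs_zero] at hxm
  linarith

open Polynomial in
lemma isIntegral_inv_of_fn_eq_zero {n : ℤ} {x : ℝ} (h : fn n x = 0) : IsIntegral ℤ x⁻¹ := by
  have hx : x ≠ 0 := by rintro rfl; norm_num [fn] at h
  refine ⟨X ^ 3 + C (n + 2) * X ^ 2 + C (n - 1) * X - 1, by monicity!, ?_⟩
  have : (x⁻¹) ^ 3 + ((n : ℝ) + 2) * (x⁻¹) ^ 2 + ((n : ℝ) - 1) * x⁻¹ - 1 = 0 := by
    unfold fn at h
    field_simp
    linear_combination -h
  simp only [eval₂_sub, eval₂_add, eval₂_mul, eval₂_pow, eval₂_X, eval₂_C, eval₂_one]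
  simpa using this

lemma fn_neg_ne_zero {n : ℤ} {x : ℝ} (h : fn n x = 0) : fn n (-x) ≠ 0 := by
  intro h'
  unfold fn at h h'
  have hx : x ≠ 0 := by rintro rfl; norm_num at h
  have hodd : x ^ 2 = n + 2 := mul_left_cancel₀ hx (by linear_combination (h - h') / 2)
  have hn : ((n : ℝ) - 1) * (n + 2) + 1 = 0 := by
    rw [← hodd]
    linear_combination -(h + h') / 2
  have hn' : n * (n + 1) = 1 := by
    have : (n : ℝ) * (n + 1) = 1 := by linear_combination hn
    exact_mod_cast this
  have := congrArg (Even ·) hn'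
  simp [Int.even_mul_succ_self] at this

theorem stmt5 (n a : ℤ) (hn : 0 ≤ n) (ha : 1 ≤ a) (ε : ℝ) (hε : 0 < ε)
    (l0 l1 l2 : ℝ) (hroots : IsOrderedRoots n l0 l1 l2) :
    {p : ℤ × ℤ | 0 < p.2 ∧
      |Fna a l0 l1 l2 (p.1 : ℝ) (p.2 : ℝ)| ≤
        (1 / 2) * (p.2 : ℝ) * (1 + ε) * |l2 ^ a - l1 ^ a| * |l0 ^ a - l2 ^ a|}.Infinite := by
  obtain ⟨h0, h1, h2, h0p, h1n, h1gt, h2lt⟩ := hroots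
  lift a to ℕ using by omega
  have ha0 : a ≠ 0 := by omega
  simp only [Fna, zpow_natCast]
  have hl2 : 1 < |l2| := by rw [abs_of_neg (by linarith)]; linarith
  have hl1 : |l1| < 1 := by rw [abs_of_neg h1n]; linarith
  have hirr : Irrational (l2 ^ a) :=
    irrational_pow_of_isIntegral_inv (isIntegral_inv_of_fn_eq_zero h2) hl2 ha0
  have hne1 : l2 ^ a ≠ l1 ^ a := fun h => by
    have := congrArg abs h
    rw [abs_pow, abs_pow] at this
    linarith [one_lt_pow₀ hl2 ha0, pow_lt_one₀ (abs_nonneg l1) hl1 ha0]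
  have hne0 : l0 ^ a ≠ l2 ^ a := fun h => by
    have := congrArg abs h
    rw [abs_pow, abs_pow, pow_left_inj₀ (abs_nonneg _) (abs_nonneg _) ha0, abs_of_pos h0p,
      abs_of_neg (by linarith : l2 < 0)] at this
    exact fn_neg_ne_zero h2 (this ▸ h0)
  set α := l2 ^ a
  set β := l1 ^ a
  set γ := l0 ^ a
  have hpos : 0 < |α - β| * |γ - α| :=
    mul_pos (abs_pos.2 (sub_ne_zero.2 hne1)) (abs_pos.2 (sub_ne_zero.2 hne0))
  have hnear : ∀ᶠ x in 𝓝 α, |x - β| * |γ - x| < (1 + ε) * (|α - β| * |γ - α|) := by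
    have hc : Continuous fun x : ℝ => |x - β| * |γ - x| := by fun_prop
    exact hc.continuousAt.eventually_lt continuousAt_const (by nlinarith)
  intro hfin
  have havoid := (hfin.image fun p : ℤ × ℤ => (p.1 / p.2 : ℝ)).isClosed.isOpen_compl.mem_nhds
    (show α ∈ _ by
      rintro ⟨p, -, hp⟩
      exact hirr ⟨p.1 / p.2, by push_cast; exact hp⟩)
  obtain ⟨p, q, hq, ⟨hU, hV⟩, hpq⟩ :=
    hirr.exists_abs_mul_sub_le_half (inter_mem hnear havoid)
  refine hV ⟨(p, q), ⟨hq, ?_⟩, rfl⟩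
  have hq' : (0 : ℝ) < q := by exact_mod_cast hq
  have hfactor : |(p - γ * q) * (p - β * q) * (p - α * q)| =
      |α * q - p| * q * q * (|(p / q : ℝ) - β| * |γ - p / q|) := by
    have e1 : (p : ℝ) - γ * q = -((γ - p / q) * q) := by field_simp; ring
    have e2 : (p : ℝ) - β * q = (p / q - β) * q := by field_simp
    rw [e1, e2, abs_mul, abs_mul, abs_neg, abs_mul, abs_mul, abs_of_pos hq',
      abs_sub_comm (p : ℝ) (α * q)]
    ring
  calc |(p - γ * q) * (p - β * q) * (p - α * q)|
      = |α * q - p| * q * q * (|(p / q : ℝ) - β| * |γ - p / q|) := hfactor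
    _ ≤ 1 / 2 * q * ((1 + ε) * (|α - β| * |γ - α|)) := by
      have hU' : |(p / q : ℝ) - β| * |γ - p / q| ≤ (1 + ε) * (|α - β| * |γ - α|) := le_of_lt hU
      gcongr
    _ = 1 / 2 * q * (1 + ε) * |α - β| * |γ - α| := by ring
end
end

section
/- For all integers n ≥ 0 and a ≥ 1, one has |λ2^a − λ1^a|·|λ0^a − λ2^a| < 2·(n+4)^a. -/
noncomputable section

/-- The coefficient of `X` in `f_n` is the second elementary symmetric function of its roots. -/
lemma fn_sum_mul_roots {n : ℤ} {x y z : ℝ} (hx : fn n x = 0) (hy : fn n y = 0) (hz : fn n z = 0)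
    (hxy : x ≠ y) (hxz : x ≠ z) (hyz : y ≠ z) : x * y + x * z + y * z = -((n : ℝ) + 2) := by
  unfold fn at hx hy hz
  have h1 : x ^ 2 + x * y + y ^ 2 - ((n : ℝ) - 1) * (x + y) - ((n : ℝ) + 2) = 0 :=
    mul_left_cancel₀ (sub_ne_zero.2 hxy) (by linear_combination hx - hy)
  have h2 : x ^ 2 + x * z + z ^ 2 - ((n : ℝ) - 1) * (x + z) - ((n : ℝ) + 2) = 0 :=
    mul_left_cancel₀ (sub_ne_zero.2 hxz) (by linear_combination hx - hz)
  have h3 : x + y + z - ((n : ℝ) - 1) = 0 :=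
    mul_left_cancel₀ (sub_ne_zero.2 hyz) (by linear_combination h1 - h2)
  linear_combination (x + y) * h3 - h1

/-- All roots of `f_n` exceed `-2` when `n ≥ 0`. -/
lemma neg_two_lt_of_fn_eq_zero {n : ℤ} (hn : 0 ≤ n) {z : ℝ} (hz : fn n z = 0) : -2 < z := by
  have hn' : (0 : ℝ) ≤ n := by exact_mod_cast hn
  unfold fn at hz
  by_contra! h
  obtain ⟨t, ht, rfl⟩ : ∃ t : ℝ, 0 ≤ t ∧ z = -2 - t := ⟨-2 - z, by linarith, by ring⟩
  nlinarith [mul_nonneg hn' ht, mul_nonneg hn' (sq_nonneg t), pow_nonneg ht 3, sq_nonneg t]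

theorem stmt6 (n a : ℤ) (hn : 0 ≤ n) (ha : 1 ≤ a)
    (l0 l1 l2 : ℝ) (hroots : IsOrderedRoots n l0 l1 l2) :
    |l2 ^ a - l1 ^ a| * |l0 ^ a - l2 ^ a| < 2 * ((n : ℝ) + 4) ^ a := by
  obtain ⟨h0, h1, h2, p0, p1, p1', p2⟩ := hroots
  have hn' : (0 : ℝ) ≤ n := by exact_mod_cast hn
  have e2 := fn_sum_mul_roots h0 h1 h2 (by linarith) (by linarith) (by linarith)
  have hu := neg_two_lt_of_fn_eq_zero hn h2
  lift a to ℕ using by lia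
  simp only [zpow_natCast]
  obtain ⟨u, rfl⟩ : ∃ u, l2 = -u := ⟨-l2, by ring⟩
  obtain ⟨v, rfl⟩ : ∃ v, l1 = -v := ⟨-l1, by ring⟩
  have u0 : 0 < u := by linarith
  have v0 : 0 < v := by linarith
  have hxu : l0 * u ≤ n + 4 := by nlinarith [mul_pos p0 v0]
  have huu : u * u ≤ n + 4 := by nlinarith
  have hvu : v ^ a ≤ u ^ a := pow_le_pow_left₀ v0.le (by linarith) a
  have hleft : |(-u) ^ a - (-v) ^ a| < u ^ a := by
    rw [neg_pow u, neg_pow v, ← mul_sub, abs_mul, abs_pow, abs_neg, abs_one, one_pow, one_mul,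
      abs_of_nonneg (sub_nonneg.2 hvu)]
    linarith [pow_pos v0 a]
  have hright : |l0 ^ a - (-u) ^ a| ≤ l0 ^ a + u ^ a := by
    refine (abs_sub _ _).trans_eq ?_
    rw [abs_pow, abs_pow, abs_neg, abs_of_pos p0, abs_of_pos u0]
  calc |(-u) ^ a - (-v) ^ a| * |l0 ^ a - (-u) ^ a|
      ≤ |(-u) ^ a - (-v) ^ a| * (l0 ^ a + u ^ a) := by gcongr
    _ < u ^ a * (l0 ^ a + u ^ a) := by gcongr
    _ = (l0 * u) ^ a + (u * u) ^ a := by rw [mul_pow, mul_pow]; ring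
    _ ≤ ((n : ℝ) + 4) ^ a + ((n : ℝ) + 4) ^ a := by gcongr
    _ = 2 * ((n : ℝ) + 4) ^ a := by ring
end
end

section
/- For every integer n, if λ is a real root of f_n, then λ ≠ 0 and λ + 1 ≠ 0, and both −1/(λ+1) and −(λ+1)/λ are also roots of f_n; moreover, the product of the three real roots of f_n equals 1. -/
noncomputable section

theorem stmt8 (n : ℤ) :
    (∀ lam : ℝ, fn n lam = 0 →
      lam ≠ 0 ∧ lam + 1 ≠ 0 ∧ fn n (-(1 / (lam + 1))) = 0 ∧ fn n (-((lam + 1) / lam)) = 0) ∧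
    (∀ l0 l1 l2 : ℝ, IsRoots n l0 l1 l2 → l0 * l1 * l2 = 1) := by
  refine ⟨fun x hx => ?_, ?_⟩
  · have h0 : x ≠ 0 := by
      rintro rfl
      norm_num [fn] at hx
    have h1 : x + 1 ≠ 0 := by
      intro h
      obtain rfl : x = -1 := by linarith
      unfold fn at hx
      linarith
    have e1 : fn n (-(1 / (x + 1))) = -fn n x / (x + 1) ^ 3 := by
      unfold fn
      field_simp
      ring
    have e2 : fn n (-((x + 1) / x)) = fn n x / x ^ 3 := by
      unfold fn
      field_simp
      ring
    exact ⟨h0, h1, by rw [e1, hx, neg_zero, zero_div], by rw [e2, hx, zero_div]⟩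
  · rintro a b c ⟨ha, hb, hc, hab, hac, hbc⟩
    unfold fn at ha hb hc
    have gab : a ^ 2 + a * b + b ^ 2 - ((n : ℝ) - 1) * (a + b) - (n + 2) = 0 :=
      mul_left_cancel₀ (sub_ne_zero.mpr hab) (by linear_combination ha - hb)
    have gac : a ^ 2 + a * c + c ^ 2 - ((n : ℝ) - 1) * (a + c) - (n + 2) = 0 :=
      mul_left_cancel₀ (sub_ne_zero.mpr hac) (by linear_combination ha - hc)
    have sum_eq : a + b + c - ((n : ℝ) - 1) = 0 :=
      mul_left_cancel₀ (sub_ne_zero.mpr hbc) (by linear_combination gab - gac)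
    linear_combination ha - a * gab + a * b * sum_eq
end
end

section
/- For every integer n ≥ 0 and every integer a ≥ 1, one has F_{n,a}(X, Y) = X³ − u_a X² Y + (−1)^a v_a X Y² − Y³ for all real X, Y; equivalently, λ0^a + λ1^a + λ2^a = u_a and (λ0 λ1)^a + (λ1 λ2)^a + (λ2 λ0)^a = (−1)^a v_a, where (u_a) and (v_a) are the integer sequences defined by the stated recurrences. -/
noncomputable section

/-- The sequence `u_0 = 3`, `u_1 = n−1`, `u_2 = n²+5`,
`u_{a+3} = (n−1)u_{a+2} + (n+2)u_{a+1} + u_a`. -/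
def useq (n : ℤ) : ℕ → ℤ
  | 0 => 3
  | 1 => n - 1
  | 2 => n ^ 2 + 5
  | a + 3 => (n - 1) * useq n (a + 2) + (n + 2) * useq n (a + 1) + useq n a

/-- The sequence `v_0 = 3`, `v_1 = n+2`, `v_2 = n²+2n+6`,
`v_{a+3} = (n+2)v_{a+2} − (n−1)v_{a+1} − v_a`. -/
def vseq (n : ℤ) : ℕ → ℤ
  | 0 => 3
  | 1 => n + 2
  | 2 => n ^ 2 + 2 * n + 6
  | a + 3 => (n + 2) * vseq n (a + 2) - (n - 1) * vseq n (a + 1) - vseq n a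

/-- Vieta's formulas for the roots of `f_n`. -/
theorem IsRoots.vieta {n : ℤ} {l0 l1 l2 : ℝ} (h : IsRoots n l0 l1 l2) :
    l0 + l1 + l2 = n - 1 ∧ l0 * l1 + l1 * l2 + l2 * l0 = -(n + 2) ∧ l0 * l1 * l2 = 1 := by
  obtain ⟨h0, h1, h2, h01, h02, h12⟩ := h
  unfold fn at h0 h1 h2
  have q01 : l0 ^ 2 + l0 * l1 + l1 ^ 2 - (n - 1) * (l0 + l1) - (n + 2) = 0 :=
    mul_left_cancel₀ (sub_ne_zero.2 h01) (by linear_combination h0 - h1)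
  have q02 : l0 ^ 2 + l0 * l2 + l2 ^ 2 - (n - 1) * (l0 + l2) - (n + 2) = 0 :=
    mul_left_cancel₀ (sub_ne_zero.2 h02) (by linear_combination h0 - h2)
  have e1 : l0 + l1 + l2 = n - 1 :=
    mul_left_cancel₀ (sub_ne_zero.2 h12) (by linear_combination q01 - q02)
  have e2 : l0 * l1 + l1 * l2 + l2 * l0 = -(n + 2) := by
    linear_combination (l0 + l1) * e1 - q01
  exact ⟨e1, e2, by linear_combination h0 - l0 ^ 2 * e1 + l0 * e2⟩

theorem IsOrderedRoots.isRoots {n : ℤ} {l0 l1 l2 : ℝ} (h : IsOrderedRoots n l0 l1 l2) :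
    IsRoots n l0 l1 l2 := by
  obtain ⟨h0, h1, h2, p0, p1, p1', p2⟩ := h
  exact ⟨h0, h1, h2, by linarith, by linarith, by linarith⟩

/-- Power sums of three numbers with elementary symmetric functions `n - 1`, `-(n + 2)`, `1`. -/
theorem powerSum_eq_useq {n : ℤ} {x y z : ℝ} (e1 : x + y + z = n - 1)
    (e2 : x * y + y * z + z * x = -(n + 2)) (e3 : x * y * z = 1) (a : ℕ) :
    x ^ a + y ^ a + z ^ a = useq n a := by
  induction a using useq.induct with
  | case1 => norm_num [useq]
  | case2 => simpa [useq] using e1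
  | case3 =>
    push_cast [useq]
    linear_combination (x + y + z + n - 1) * e1 - 2 * e2
  | case4 a h2 h1 h0 =>
    push_cast [useq]
    simp only [Nat.succ_eq_add_one]
    rw [← h2, ← h1, ← h0]
    linear_combination (x ^ (a + 2) + y ^ (a + 2) + z ^ (a + 2)) * e1
      - (x ^ (a + 1) + y ^ (a + 1) + z ^ (a + 1)) * e2 + (x ^ a + y ^ a + z ^ a) * e3

/-- Power sums of three numbers with elementary symmetric functions `-(n + 2)`, `n - 1`, `1`. -/
theorem powerSum_eq_vseq {n : ℤ} {x y z : ℝ} (e1 : x + y + z = -(n + 2))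
    (e2 : x * y + y * z + z * x = n - 1) (e3 : x * y * z = 1) (a : ℕ) :
    x ^ a + y ^ a + z ^ a = (-1) ^ a * vseq n a := by
  induction a using vseq.induct with
  | case1 => norm_num [vseq]
  | case2 =>
    push_cast [vseq]
    linear_combination e1
  | case3 =>
    push_cast [vseq]
    linear_combination (x + y + z - n - 2) * e1 - 2 * e2
  | case4 a h2 h1 h0 =>
    push_cast [vseq]
    simp only [Nat.succ_eq_add_one]
    linear_combination (x ^ (a + 2) + y ^ (a + 2) + z ^ (a + 2)) * e1
      - (x ^ (a + 1) + y ^ (a + 1) + z ^ (a + 1)) * e2 + (x ^ a + y ^ a + z ^ a) * e3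
      - (n + 2) * h2 - (n - 1) * h1 + h0

theorem stmt10 (n : ℤ) (hn : 0 ≤ n) (a : ℕ) (ha : 1 ≤ a)
    (l0 l1 l2 : ℝ) (hroots : IsOrderedRoots n l0 l1 l2) :
    (∀ X Y : ℝ, Fna (a : ℤ) l0 l1 l2 X Y =
        X ^ 3 - (useq n a : ℝ) * X ^ 2 * Y + (-1 : ℝ) ^ a * (vseq n a : ℝ) * X * Y ^ 2 - Y ^ 3) ∧
    l0 ^ a + l1 ^ a + l2 ^ a = (useq n a : ℝ) ∧
    (l0 * l1) ^ a + (l1 * l2) ^ a + (l2 * l0) ^ a = (-1 : ℝ) ^ a * (vseq n a : ℝ) := by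
  obtain ⟨e1, e2, e3⟩ := hroots.isRoots.vieta
  have hu := powerSum_eq_useq e1 e2 e3 a
  have hv : (l0 * l1) ^ a + (l1 * l2) ^ a + (l2 * l0) ^ a = (-1 : ℝ) ^ a * (vseq n a : ℝ) :=
    powerSum_eq_vseq e2 (by linear_combination l0 * l1 * l2 * e1 + (n - 1) * e3)
      (by linear_combination (l0 * l1 * l2 + 1) * e3) a
  refine ⟨fun X Y => ?_, hu, hv⟩
  have hp : l0 ^ a * l1 ^ a * l2 ^ a = 1 := by rw [← mul_pow, ← mul_pow, e3, one_pow]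
  simp only [mul_pow] at hv
  simp only [Fna, zpow_natCast]
  linear_combination -X ^ 2 * Y * hu + X * Y ^ 2 * hv - Y ^ 3 * hp
end
end

section
/- For all integers n ≥ 1 and a ≥ 1, one has u_a > 0, except for (n, a) = (1, 1), in which case u_1 = 0. -/
theorem useq_succ_nonneg_and_pos {n : ℤ} (hn : 1 ≤ n) (a : ℕ) :
    0 ≤ useq n (a + 1) ∧ 0 < useq n (a + 2) ∧ 0 < useq n (a + 3) := by
  have hn' : 0 ≤ n - 1 := by linarith
  induction a with
  | zero =>
    refine ⟨by simpa [useq] using hn, by simp only [useq]; positivity, ?_⟩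
    simp only [useq]
    have : 0 ≤ (n - 1) * (n ^ 2 + 5) := mul_nonneg hn' (by positivity)
    have : 0 ≤ (n + 2) * (n - 1) := mul_nonneg (by linarith) hn'
    linarith
  | succ a ih =>
    obtain ⟨h₁, h₂, h₃⟩ := ih
    refine ⟨h₂.le, h₃, ?_⟩
    rw [useq]
    have : 0 < (n + 2) * useq n (a + 1 + 1) := mul_pos (by linarith) h₂
    have : 0 ≤ (n - 1) * useq n (a + 1 + 2) := mul_nonneg hn' h₃.le
    linarith

theorem stmt11 :
    (∀ (n : ℤ) (a : ℕ), 1 ≤ n → 1 ≤ a → ¬(n = 1 ∧ a = 1) → 0 < useq n a) ∧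
    useq 1 1 = 0 := by
  refine ⟨fun n a hn ha hne => ?_, by simp [useq]⟩
  match a, ha with
  | 1, _ =>
    have : n ≠ 1 := fun h => hne ⟨h, rfl⟩
    simp only [useq]
    lia
  | a + 2, _ => exact (useq_succ_nonneg_and_pos hn a).2.1
end

section
/- For all integers n ≥ 1 and a ≥ 2, one has 2·u_a > n·u_{a−1}, except for (n, a) = (1, 3), in which case 2·u_3 = u_2 (and hence 2·u_3 = n·u_2). -/
theorem useq_add_three (n : ℤ) (a : ℕ) :
    useq n (a + 3) = (n - 1) * useq n (a + 2) + (n + 2) * useq n (a + 1) + useq n a := by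
  rw [useq]

/-- The difference `2 u_{a+1} - n u_a`; it satisfies the same recurrence as `useq`. -/
def useqDiff (n : ℤ) (a : ℕ) : ℤ := 2 * useq n (a + 1) - n * useq n a

theorem useqDiff_add_three (n : ℤ) (a : ℕ) :
    useqDiff n (a + 3) =
      (n - 1) * useqDiff n (a + 2) + (n + 2) * useqDiff n (a + 1) + useqDiff n a := by
  simp only [useqDiff, useq_add_three n a, useq_add_three n (a + 1)]
  ring

theorem useqDiff_one (n : ℤ) : useqDiff n 1 = n ^ 2 + n + 10 := by
  simp only [useqDiff, useq]
  ring

theorem useqDiff_two (n : ℤ) : useqDiff n 2 = (n - 1) * (n ^ 2 + n + 8) := by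
  simp only [useqDiff, useq]
  ring

theorem useqDiff_three (n : ℤ) :
    useqDiff n 3 = (n - 1) ^ 2 * (n ^ 2 + n + 8) + (n + 2) * (n ^ 2 + n + 9) := by
  simp only [useqDiff, useq]
  ring

theorem useqDiff_add_three_pos {n : ℤ} (hn : 1 ≤ n) (a : ℕ) : 0 < useqDiff n (a + 3) := by
  have hn₁ : 0 ≤ n - 1 := by linarith
  have hn₂ : 0 < n + 2 := by linarith
  have h₁ : 0 < useqDiff n 1 := by rw [useqDiff_one]; positivity
  have h₂ : 0 ≤ useqDiff n 2 := by rw [useqDiff_two]; positivity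
  have h₃ : 0 < useqDiff n 3 := by rw [useqDiff_three]; positivity
  have h₄ : 0 < useqDiff n 4 := by rw [useqDiff_add_three n 1]; positivity
  have h₅ : 0 < useqDiff n 5 := by rw [useqDiff_add_three n 2]; positivity
  suffices h : 0 < useqDiff n (a + 3) ∧ 0 < useqDiff n (a + 4) ∧ 0 < useqDiff n (a + 5) from h.1
  induction a with
  | zero => exact ⟨h₃, h₄, h₅⟩
  | succ a ih =>
    obtain ⟨ih₁, ih₂, ih₃⟩ := ih
    rw [show a + 1 + 3 = a + 4 by ring, show a + 1 + 4 = a + 5 by ring]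
    refine ⟨ih₂, ih₃, ?_⟩
    rw [show a + 1 + 5 = a + 3 + 3 by ring, useqDiff_add_three n (a + 3)]
    positivity

theorem stmt12 :
    (∀ (n : ℤ) (a : ℕ), 1 ≤ n → 2 ≤ a → ¬(n = 1 ∧ a = 3) → n * useq n (a - 1) < 2 * useq n a) ∧
    2 * useq 1 3 = useq 1 2 := by
  refine ⟨fun n a hn ha hna => ?_, by simp [useq]⟩
  obtain ⟨b, rfl⟩ := Nat.exists_eq_add_of_le' ha
  suffices h : 0 < useqDiff n (b + 1) from sub_pos.mp h
  match b with
  | 0 => rw [useqDiff_one]; positivity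
  | 1 =>
    have h : 0 < n - 1 := by
      have : n ≠ 1 := fun h => hna ⟨h, rfl⟩
      omega
    rw [useqDiff_two]
    positivity
  | b + 2 => exact useqDiff_add_three_pos hn b
end

section
/- For all integers n ≥ 1 and a ≥ 2, one has v_a > u_a + v_{a−1}, except for (n, a) = (1, 2), in which case v_2 = u_2 + v_1. Moreover, for every integer n ≥ 0 one has v_1 = u_1 + v_0, and for all integers n ≥ 0 and a ≥ 1 one has |u_a| ≤ v_a. -/
/-- A real root of the characteristic cubic of `useq n` in `[c, n + 2]`. -/
theorem exists_root_charpoly {n c : ℝ} (hn : 0 ≤ n) (hc : c ≤ 2)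
    (h : c ^ 3 + c ^ 2 - 2 * c - 1 ≤ n * (c ^ 2 + c)) :
    ∃ x : ℝ, c ≤ x ∧ x ^ 3 + x ^ 2 - 2 * x - 1 = n * (x ^ 2 + x) := by
  have hcont : ContinuousOn (fun x : ℝ => x ^ 3 + x ^ 2 - 2 * x - 1 - n * (x ^ 2 + x))
      (Set.Icc c (n + 2)) := by fun_prop
  have hmem : (0 : ℝ) ∈ Set.Icc (c ^ 3 + c ^ 2 - 2 * c - 1 - n * (c ^ 2 + c))
      ((n + 2) ^ 3 + (n + 2) ^ 2 - 2 * (n + 2) - 1 - n * ((n + 2) ^ 2 + (n + 2))) := by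
    constructor
    · linarith
    · nlinarith [sq_nonneg n]
  obtain ⟨x, hx, hfx⟩ := intermediate_value_Icc (by linarith) hcont hmem
  exact ⟨x, hx.1, sub_eq_zero.mp hfx⟩

theorem useq_eq_sum_pow {n : ℤ} {x : ℝ} (hx : 0 < x)
    (h : x ^ 3 + x ^ 2 - 2 * x - 1 = n * (x ^ 2 + x)) (a : ℕ) :
    (useq n a : ℝ) = x ^ a + (-(1 / (x + 1))) ^ a + (-((x + 1) / x)) ^ a := by
  have hn : (n : ℝ) = (x ^ 3 + x ^ 2 - 2 * x - 1) / (x * (x + 1)) := by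
    rw [eq_div_iff (by positivity), h]; ring
  induction a using useq.induct with
  | case1 => norm_num [useq]
  | case2 => simp only [useq]; push_cast; rw [hn]; field_simp; ring
  | case3 => simp only [useq]; push_cast; rw [hn]; field_simp; ring
  | case4 a h2 h1 h0 =>
    have key : ∀ y : ℝ, y ^ 3 = (n - 1) * y ^ 2 + (n + 2) * y + 1 →
        y ^ (a + 3) = (n - 1) * y ^ (a + 2) + (n + 2) * y ^ (a + 1) + y ^ a := by
      intro y hy
      rw [pow_add, hy]; ring
    simp only [useq]
    push_cast
    rw [h2, h1, h0, key x (by linear_combination h),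
      key (-(1 / (x + 1))) (by rw [hn]; field_simp; ring),
      key (-((x + 1) / x)) (by rw [hn]; field_simp; ring)]
    ring

theorem vseq_eq_sum_pow {n : ℤ} {x : ℝ} (hx : 0 < x)
    (h : x ^ 3 + x ^ 2 - 2 * x - 1 = n * (x ^ 2 + x)) (a : ℕ) :
    (vseq n a : ℝ) = (x + 1) ^ a + (x / (x + 1)) ^ a + (-(1 / x)) ^ a := by
  have hn : (n : ℝ) = (x ^ 3 + x ^ 2 - 2 * x - 1) / (x * (x + 1)) := by
    rw [eq_div_iff (by positivity), h]; ring
  induction a using vseq.induct with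
  | case1 => norm_num [vseq]
  | case2 => simp only [vseq]; push_cast; rw [hn]; field_simp; ring
  | case3 => simp only [vseq]; push_cast; rw [hn]; field_simp; ring
  | case4 a h2 h1 h0 =>
    have key : ∀ y : ℝ, y ^ 3 = (n + 2) * y ^ 2 - (n - 1) * y - 1 →
        y ^ (a + 3) = (n + 2) * y ^ (a + 2) - (n - 1) * y ^ (a + 1) - y ^ a := by
      intro y hy
      rw [pow_add, hy]; ring
    simp only [vseq]
    push_cast
    rw [h2, h1, h0, key (x + 1) (by linear_combination h),
      key (x / (x + 1)) (by rw [hn]; field_simp; ring),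
      key (-(1 / x)) (by rw [hn]; field_simp; ring)]
    ring

theorem abs_useq_le_vseq {n : ℤ} (hn : 0 ≤ n) {a : ℕ} (ha : 1 ≤ a) :
    |useq n a| ≤ vseq n a := by
  obtain rfl | rfl | ha : a = 1 ∨ a = 2 ∨ 3 ≤ a := by omega
  · simp only [useq, vseq, abs_le]; constructor <;> linarith
  · simp only [useq, vseq, abs_le]; constructor <;> nlinarith
  have hn' : (0 : ℝ) ≤ n := by exact_mod_cast hn
  obtain ⟨x, hx, h⟩ := exists_root_charpoly (c := 6 / 5) hn' (by norm_num) (by linarith)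
  have hx0 : 0 < x := by linarith
  have hgoal : |(useq n a : ℝ)| ≤ vseq n a := by
    rw [useq_eq_sum_pow hx0 h, vseq_eq_sum_pow hx0 h]
    have hP : x ^ 3 ≤ x ^ a := pow_le_pow_right₀ (by linarith) ha
    have hτ : 1 ≤ (x + 1) / x := by rw [le_div_iff₀ hx0]; linarith
    have hT : ((x + 1) / x) ^ 3 ≤ ((x + 1) / x) ^ a := pow_le_pow_right₀ hτ ha
    have hPT : (x + 1) ^ a = x ^ a * ((x + 1) / x) ^ a := by
      rw [← mul_pow, mul_div_cancel₀ _ hx0.ne']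
    have hσ : |(-(1 / (x + 1))) ^ a| ≤ 1 := by
      rw [abs_pow, abs_neg, abs_of_pos (by positivity)]
      exact pow_le_one₀ (by positivity) (by rw [div_le_one (by linarith)]; linarith)
    have hr : |(-(1 / x)) ^ a| ≤ 1 := by
      rw [abs_pow, abs_neg, abs_of_pos (by positivity)]
      exact pow_le_one₀ (by positivity) (by rw [div_le_one (by linarith)]; linarith)
    have hτa : |(-((x + 1) / x)) ^ a| = ((x + 1) / x) ^ a := by
      rw [abs_pow, abs_neg, abs_of_pos (by positivity)]
    have hs : 0 ≤ (x / (x + 1)) ^ a := by positivity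
    have hx3 : 1 ≤ x ^ 3 := one_le_pow₀ (by linarith)
    have hbase : 3 ≤ (x ^ 3 - 1) * (((x + 1) / x) ^ 3 - 1) := by
      rw [div_pow, div_sub_one (by positivity), mul_div_assoc', le_div_iff₀ (by positivity)]
      obtain ⟨t, ht, rfl⟩ : ∃ t : ℝ, 0 ≤ t ∧ x = 6 / 5 + t := ⟨x - 6 / 5, by linarith, by ring⟩
      ring_nf
      nlinarith [pow_nonneg ht 2, pow_nonneg ht 3, pow_nonneg ht 4, pow_nonneg ht 5]
    have hprod : 3 ≤ (x ^ a - 1) * (((x + 1) / x) ^ a - 1) :=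
      hbase.trans (mul_le_mul (by linarith) (by linarith)
        (sub_nonneg.mpr (one_le_pow₀ hτ)) (by linarith))
    have hxa : |x ^ a| = x ^ a := abs_of_pos (by positivity)
    have h1 := abs_add_le (x ^ a + (-(1 / (x + 1))) ^ a) ((-((x + 1) / x)) ^ a)
    have h2 := abs_add_le (x ^ a) ((-(1 / (x + 1))) ^ a)
    have h3 := neg_abs_le ((-(1 / x)) ^ a)
    rw [hPT]
    linarith
  exact_mod_cast hgoal

theorem useq_add_vseq_lt_vseq_succ {n : ℤ} (hn : 1 ≤ n) {b : ℕ} (hb : 2 ≤ b) :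
    useq n (b + 1) + vseq n b < vseq n (b + 1) := by
  have hn' : (1 : ℝ) ≤ n := by exact_mod_cast hn
  obtain ⟨x, hx, h⟩ := exists_root_charpoly (n := n) (c := 9 / 5) (by linarith) (by norm_num)
    (by linarith)
  have hx0 : 0 < x := by linarith
  have hgoal : (useq n (b + 1) : ℝ) + vseq n b < vseq n (b + 1) := by
    rw [useq_eq_sum_pow hx0 h, vseq_eq_sum_pow hx0 h, vseq_eq_sum_pow hx0 h]
    have hP : x ^ 2 ≤ x ^ b := pow_le_pow_right₀ (by linarith) hb
    have hτ : 1 ≤ (x + 1) / x := by rw [le_div_iff₀ hx0]; linarith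
    have hτ' : (x + 1) / x ≤ 14 / 9 := by rw [div_le_iff₀ hx0]; linarith
    have hT : ((x + 1) / x) ^ 2 ≤ ((x + 1) / x) ^ b := pow_le_pow_right₀ hτ hb
    have hPT : (x + 1) ^ b = x ^ b * ((x + 1) / x) ^ b := by
      rw [← mul_pow, mul_div_cancel₀ _ hx0.ne']
    have hs : 1 / (x + 1) ≤ 5 / 14 := by rw [div_le_iff₀ (by linarith)]; linarith
    have hr : 1 / x ≤ 5 / 9 := by rw [div_le_iff₀ (by linarith)]; linarith
    have hσ : (-(1 / (x + 1))) ^ (b + 1) ≤ 1 := by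
      refine (le_abs_self _).trans ?_
      rw [abs_pow, abs_neg, abs_of_pos (by positivity)]
      exact pow_le_one₀ (by positivity) (by linarith)
    have hμ : (x / (x + 1)) ^ b - (x / (x + 1)) ^ (b + 1) ≤ 5 / 14 := by
      have h1 : (x / (x + 1)) ^ b ≤ 1 :=
        pow_le_one₀ (by positivity) (by rw [div_le_one (by linarith)]; linarith)
      have h2 : (x / (x + 1)) ^ b - (x / (x + 1)) ^ (b + 1)
          = (x / (x + 1)) ^ b * (1 / (x + 1)) := by
        rw [pow_succ]; field_simp; ring
      rw [h2]
      exact (mul_le_of_le_one_left (by positivity) h1).trans hs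
    have hν : (-(1 / x)) ^ b - (-(1 / x)) ^ (b + 1) ≤ 14 / 9 := by
      have h1 : (-(1 / x)) ^ b ≤ 1 := by
        refine (le_abs_self _).trans ?_
        rw [abs_pow, abs_neg, abs_of_pos (by positivity)]
        exact pow_le_one₀ (by positivity) (by linarith)
      have h2 : 0 < 1 / x := by positivity
      rw [pow_succ]
      nlinarith
    have hτb : (-((x + 1) / x)) ^ (b + 1) ≤ ((x + 1) / x) ^ b * (14 / 9) := by
      refine (le_abs_self _).trans ?_
      rw [abs_pow, abs_neg, abs_of_pos (by positivity), pow_succ]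
      gcongr
    have hmain : 1 + 5 / 14 + 14 / 9 + ((x + 1) / x) ^ b * (14 / 9)
        < x * (x ^ b * (((x + 1) / x) ^ b - 1)) := by
      have hT1 : 0 ≤ ((x + 1) / x) ^ b - 1 := sub_nonneg.mpr (one_le_pow₀ hτ)
      have h1 : x ^ 3 * (((x + 1) / x) ^ b - 1) ≤ x * (x ^ b * (((x + 1) / x) ^ b - 1)) := by
        nlinarith [mul_le_mul_of_nonneg_left
          (mul_le_mul_of_nonneg_right hP hT1) hx0.le]
      have hx3 : (9 / 5 : ℝ) ^ 3 ≤ x ^ 3 := pow_le_pow_left₀ (by norm_num) hx 3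
      have h2 : (x ^ 3 - 14 / 9) * (((x + 1) / x) ^ 2 - 1)
          ≤ (x ^ 3 - 14 / 9) * (((x + 1) / x) ^ b - 1) :=
        mul_le_mul_of_nonneg_left (by linarith) (by norm_num at hx3; linarith)
      have h3 : 1 + 5 / 14 + 14 / 9 + 14 / 9 < (x ^ 3 - 14 / 9) * (((x + 1) / x) ^ 2 - 1) := by
        rw [div_pow, div_sub_one (by positivity), mul_div_assoc', lt_div_iff₀ (by positivity)]
        obtain ⟨t, ht, rfl⟩ : ∃ t : ℝ, 0 ≤ t ∧ x = 9 / 5 + t := ⟨x - 9 / 5, by linarith, by ring⟩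
        ring_nf
        nlinarith [pow_nonneg ht 2, pow_nonneg ht 3, pow_nonneg ht 4]
      linarith
    have hxb : (x + 1) ^ (b + 1) - (x + 1) ^ b - x ^ (b + 1)
        = x * (x ^ b * (((x + 1) / x) ^ b - 1)) := by
      rw [pow_succ, hPT]; ring
    linarith
  exact_mod_cast hgoal

theorem stmt13 :
    (∀ (n : ℤ) (a : ℕ), 1 ≤ n → 2 ≤ a → ¬(n = 1 ∧ a = 2) →
      useq n a + vseq n (a - 1) < vseq n a) ∧
    vseq 1 2 = useq 1 2 + vseq 1 1 ∧
    (∀ n : ℤ, 0 ≤ n → vseq n 1 = useq n 1 + vseq n 0) ∧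
    (∀ (n : ℤ) (a : ℕ), 0 ≤ n → 1 ≤ a → |useq n a| ≤ vseq n a) := by
  refine ⟨fun n a hn ha hna => ?_, by norm_num [useq, vseq], fun n _ => ?_,
    fun n a hn ha => abs_useq_le_vseq hn ha⟩
  · obtain rfl | ha : a = 2 ∨ 3 ≤ a := by omega
    · have hn1 : 1 < n := by omega
      simp only [useq, vseq, show 2 - 1 = 1 from rfl]
      linarith
    · obtain ⟨b, rfl⟩ : ∃ b, a = b + 1 := ⟨a - 1, by omega⟩
      exact useq_add_vseq_lt_vseq_succ hn (by omega)
  · simp only [useq, vseq]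
    ring
end

section
/- For n = 0 and every integer a ≥ 1, one has 0 < (−1)^a·u_a ≤ v_a/2, except for a = 2, where (u_2, v_2) = (5, 6). -/
/-- The recurrence of `(-1) ^ a * useq 0 a`. -/
theorem signed_useq_zero_add_three (a : ℕ) :
    (-1 : ℤ) ^ (a + 3) * useq 0 (a + 3) = (-1) ^ (a + 2) * useq 0 (a + 2) +
      2 * ((-1) ^ (a + 1) * useq 0 (a + 1)) - (-1) ^ a * useq 0 a := by
  rw [useq]
  ring

theorem vseq_zero_add_three (a : ℕ) :
    vseq 0 (a + 3) = 2 * vseq 0 (a + 2) + vseq 0 (a + 1) - vseq 0 a := by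
  rw [vseq]
  ring

theorem signed_useq_zero_monotone (a : ℕ) :
    0 < (-1 : ℤ) ^ (a + 4) * useq 0 (a + 4) ∧
    (-1 : ℤ) ^ (a + 4) * useq 0 (a + 4) ≤ (-1) ^ (a + 5) * useq 0 (a + 5) ∧
    (-1 : ℤ) ^ (a + 5) * useq 0 (a + 5) ≤ (-1) ^ (a + 6) * useq 0 (a + 6) := by
  induction a with
  | zero => norm_num [useq]
  | succ a ih =>
    have h := signed_useq_zero_add_three (a + 4)
    simp only [Nat.add_assoc, Nat.reduceAdd] at ih h ⊢
    refine ⟨?_, ?_, ?_⟩ <;> linarith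

theorem vseq_sub_signed_useq_zero_monotone (a : ℕ) :
    0 ≤ vseq 0 (a + 4) - 2 * ((-1) ^ (a + 4) * useq 0 (a + 4)) ∧
    vseq 0 (a + 4) - 2 * ((-1) ^ (a + 4) * useq 0 (a + 4)) ≤
      vseq 0 (a + 5) - 2 * ((-1) ^ (a + 5) * useq 0 (a + 5)) ∧
    vseq 0 (a + 5) - 2 * ((-1) ^ (a + 5) * useq 0 (a + 5)) ≤
      vseq 0 (a + 6) - 2 * ((-1) ^ (a + 6) * useq 0 (a + 6)) := by
  induction a with
  | zero => norm_num [useq, vseq]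
  | succ a ih =>
    have hu := signed_useq_zero_add_three (a + 4)
    have hv := vseq_zero_add_three (a + 4)
    have hm := signed_useq_zero_monotone a
    simp only [Nat.add_assoc, Nat.reduceAdd] at ih hu hv hm ⊢
    refine ⟨?_, ?_, ?_⟩ <;> linarith

theorem stmt15 :
    (∀ a : ℕ, 1 ≤ a → a ≠ 2 →
      0 < (-1 : ℤ) ^ a * useq 0 a ∧ 2 * ((-1 : ℤ) ^ a * useq 0 a) ≤ vseq 0 a) ∧
    useq 0 2 = 5 ∧ vseq 0 2 = 6 := by
  refine ⟨fun a ha ha2 => ?_, by norm_num [useq], by norm_num [vseq]⟩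
  rcases lt_or_ge a 4 with h | h
  · interval_cases a <;> simp_all [useq, vseq]
  · obtain ⟨b, rfl⟩ := Nat.exists_eq_add_of_le' h
    have := signed_useq_zero_monotone b
    have := vseq_sub_signed_useq_zero_monotone b
    omega
end

section
/- For every integer n ≥ 1, the roots λ0 and λ2 of f_n satisfy | log|λ2| − 1/λ0 | ≤ 1/(2·λ0²). -/
noncomputable section

/-- `f_n` is compatible with the order-three Möbius map `x ↦ -1 - 1/x`, which permutes its roots. -/
lemma fn_neg_one_sub_inv (n : ℤ) {x : ℝ} (hx : x ≠ 0) (h : fn n x = 0) :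
    fn n (-1 - 1 / x) = 0 := by
  have key : fn n (-1 - 1 / x) = fn n x / x ^ 3 := by
    unfold fn
    field_simp
    ring
  rw [key, h, zero_div]

/-- `f_n` has at most one root below `-1`. -/
lemma eq_of_fn_eq_zero_of_lt_neg_one (n : ℤ) {a b : ℝ} (ha : a < -1) (hb : b < -1)
    (hfa : fn n a = 0) (hfb : fn n b = 0) : a = b := by
  have hab : 0 < a * b := mul_pos_of_neg_of_neg (by linarith) (by linarith)
  have hab' : 0 < (a + 1) * (b + 1) := mul_pos_of_neg_of_neg (by linarith) (by linarith)
  have key : (a - b) * (a * b * ((a + 1) * (b + 1)) + (a + 1) * (b + 1) + a * b) = 0 := by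
    unfold fn at hfa hfb
    linear_combination (b * (b + 1)) * hfa - (a * (a + 1)) * hfb
  rcases mul_eq_zero.mp key with h | h
  · linarith
  · nlinarith [mul_pos hab hab']

lemma abs_log_one_add_sub_le {x : ℝ} (hx : 0 ≤ x) : |Real.log (1 + x) - x| ≤ x ^ 2 / 2 := by
  have upper : Real.log (1 + x) ≤ x := by
    linarith [Real.log_le_sub_one_of_pos (show 0 < 1 + x by linarith)]
  have lower : x - x ^ 2 / 2 ≤ Real.log (1 + x) := by
    refine le_trans ?_ (Real.le_log_one_add_of_nonneg hx)
    rw [le_div_iff₀ (by linarith)]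
    nlinarith [pow_nonneg hx 3]
  rw [abs_le]
  constructor <;> nlinarith [sq_nonneg x]

theorem stmt18 (n : ℤ) (hn : 1 ≤ n) (l0 l1 l2 : ℝ)
    (hroots : IsOrderedRoots n l0 l1 l2) :
    |Real.log |l2| - 1 / l0| ≤ 1 / (2 * l0 ^ 2) := by
  obtain ⟨h0, -, h2, hl0, -, -, hl2⟩ := hroots
  have hinv : 0 < 1 / l0 := by positivity
  have hl2_eq : l2 = -1 - 1 / l0 :=
    eq_of_fn_eq_zero_of_lt_neg_one n hl2 (by linarith) h2 (fn_neg_one_sub_inv n hl0.ne' h0)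
  have habs : |l2| = 1 + 1 / l0 := by
    rw [abs_of_neg (by linarith), hl2_eq]
    ring
  rw [habs]
  calc |Real.log (1 + 1 / l0) - 1 / l0| ≤ (1 / l0) ^ 2 / 2 := abs_log_one_add_sub_le hinv.le
    _ = 1 / (2 * l0 ^ 2) := by field_simp
end
end
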